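/- Let d ≥ 1, k ≥ 1 be fixed integers, s ∈ (0,2] and L > 0. There exists a constant C depending only on s, L, k and d such that for every n > k and every probability density f in the Hölder ball H^s_d(L;[0,1]^d), if X_1,…,X_n are i.i.d. samples from f, then (E[(ĥ_{n,k}(X) − h(f))^2])^{1/2} ≤ C ( n^{−s/(s+d)} ln(n+1) + n^{−1/2} ), where ĥ_{n,k} is the Kozachenko–Leonenko k-nearest neighbor differential entropy estimator and h(f) is the differential entropy of f. -/

import Mathlib

open MeasureTheory Real

noncomputable section

abbrev Euc (d : ℕ) : Type := EuclideanSpace ℝ (Fin d)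

/-- The unit cube `[0,1]^d`. -/
def unitCube (d : ℕ) : Set (Euc d) := {x | ∀ i, x i ∈ Set.Icc (0:ℝ) 1}

/-- Volume of the unit Euclidean ball in `ℝ^d`. -/
def unitBallVol (d : ℕ) : ℝ := Real.pi ^ ((d : ℝ) / 2) / Real.Gamma (1 + (d : ℝ) / 2)

/-- The point of `ℝ^d` with integer coordinates `m`. -/
def intVec (d : ℕ) (m : Fin d → ℤ) : Euc d :=
  (WithLp.equiv 2 (Fin d → ℝ)).symm fun i => (m i : ℝ)

/-- Torus distance: `d(x,y) = min_{m ∈ ℤ^d} ‖x + m - y‖`. -/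
def torusDist (d : ℕ) (x y : Euc d) : ℝ :=
  ⨅ m : Fin d → ℤ, ‖x + intVec d m - y‖

/-- `(s,L)`-Hölder condition for `s ∈ (0,2]`. -/
def IsHolderOrder (d : ℕ) (s L : ℝ) (f : Euc d → ℝ) : Prop :=
  if s ≤ 1 then
    ∀ x y : Euc d, |f x - f y| ≤ L * ‖x - y‖ ^ s
  else
    ContDiff ℝ 1 f ∧ ∀ x y : Euc d, ‖gradient f x - gradient f y‖ ≤ L * ‖x - y‖ ^ (s - 1)

/-- `f` is 1-periodic in each coordinate. -/
def IsPeriodic (d : ℕ) (f : Euc d → ℝ) : Prop :=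
  ∀ (x : Euc d) (i : Fin d), f (x + EuclideanSpace.single i 1) = f x

/-- Probability density in the Hölder ball `H^s_d(L;[0,1]^d)`, represented by its
1-periodic extension to `ℝ^d`. -/
def HolderDensity (d : ℕ) (s L : ℝ) (f : Euc d → ℝ) : Prop :=
  IsHolderOrder d s L f ∧ IsPeriodic d f ∧ (∀ x, 0 ≤ f x) ∧
    (∫ x in unitCube d, f x) = 1

/-- The probability measure on `[0,1]^d` with density `f`. -/
def densityMeasure (d : ℕ) (f : Euc d → ℝ) : Measure (Euc d) :=
  (volume.restrict (unitCube d)).withDensity fun x => ENNReal.ofReal (f x)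

/-- Law of `n` i.i.d. samples from density `f`. -/
def sampleMeasure (d n : ℕ) (f : Euc d → ℝ) : Measure (Fin n → Euc d) :=
  Measure.pi fun _ => densityMeasure d f

/-- The `k`-th smallest element (1-indexed) of a multiset of reals. -/
def kthSmallest (s : Multiset ℝ) (k : ℕ) : ℝ :=
  (s.sort (· ≤ ·)).getD (k - 1) 0

/-- `R_{i,k}`: the `k`-nearest neighbor torus distance from `X i` to the other points. -/
def nnDist (d n : ℕ) (X : Fin n → Euc d) (i : Fin n) (k : ℕ) : ℝ :=
  kthSmallest ((Finset.univ.erase i).val.map fun j => torusDist d (X i) (X j)) k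

/-- The digamma function: derivative of `ln Γ`. -/
def digamma (x : ℝ) : ℝ := deriv (fun y => Real.log (Real.Gamma y)) x

/-- The Kozachenko–Leonenko `k`-nearest neighbor differential entropy estimator. -/
def klEstimator (d k n : ℕ) (X : Fin n → Euc d) : ℝ :=
  Real.log k - digamma k +
    (1 / n : ℝ) * ∑ i : Fin n, Real.log ((n / k : ℝ) * (unitBallVol d * nnDist d n X i k ^ d))

/-- Differential entropy `h(f) = -∫_{[0,1]^d} f ln f`. -/
def diffEntropy (d : ℕ) (f : Euc d → ℝ) : ℝ :=
  -∫ x in unitCube d, f x * Real.log (f x)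

end

noncomputable section

/-! ### Order statistics -/

theorem List.Pairwise.getD_le_iff {l : List ℝ} (hl : l.Pairwise (· ≤ ·)) {i : ℕ}
    (hi : i < l.length) (r : ℝ) : l.getD i 0 ≤ r ↔ i + 1 ≤ l.countP (· ≤ r) := by
  induction l generalizing i with
  | nil => simp at hi
  | cons a l ih =>
    rw [List.pairwise_cons] at hl
    by_cases har : a ≤ r
    · cases i with
      | zero => simp [har]
      | succ i =>
        have := ih hl.2 (i := i) (by simpa using hi)
        simp only [List.getD_cons_succ, this, List.countP_cons, har, decide_true, if_true]
        omega
    · have h0 : (a :: l).countP (· ≤ r) = 0 := by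
        rw [List.countP_eq_zero]
        intro b hb
        rcases List.mem_cons.1 hb with rfl | hb
        · simpa using har
        · have := hl.1 b hb
          simp only [decide_eq_true_eq, not_le] at har ⊢
          linarith
      rw [h0]
      have hmem : (a :: l).getD i 0 ∈ a :: l := by
        rw [List.getD_eq_getElem _ _ hi]; exact List.getElem_mem hi
      have : a ≤ (a :: l).getD i 0 := by
        rcases List.mem_cons.1 hmem with h | h
        · exact h.ge
        · exact hl.1 _ h
      constructor
      · intro h; exact absurd (this.trans h) har
      · intro h; omega

/-- The `k`-th smallest of the values `a j`, `j ∈ S`. -/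
def ordStat {ι : Type*} (S : Finset ι) (a : ι → ℝ) (k : ℕ) : ℝ := kthSmallest (S.val.map a) k

theorem ordStat_le_iff {ι : Type*} {S : Finset ι} {a : ι → ℝ} {k : ℕ} (hk : 1 ≤ k)
    (hkS : k ≤ S.card) (r : ℝ) : ordStat S a k ≤ r ↔ k ≤ (S.filter (a · ≤ r)).card := by
  unfold ordStat kthSmallest
  rw [List.Pairwise.getD_le_iff (Multiset.pairwise_sort _ _)
    (by rw [Multiset.length_sort]; simp; omega)]
  have h1 : (Multiset.sort (S.val.map a) (· ≤ ·)).countP (· ≤ r)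
      = (S.val.map a).countP (· ≤ r) := by
    conv_rhs => rw [← Multiset.sort_eq (S.val.map a) (· ≤ ·)]
    rw [Multiset.coe_countP]
  rw [h1, Multiset.countP_map, ← Finset.filter_val, Finset.card_val]
  omega

theorem exists_ordStat_eq {ι : Type*} {S : Finset ι} (a : ι → ℝ) {k : ℕ} (hk : 1 ≤ k)
    (hkS : k ≤ S.card) : ∃ j ∈ S, ordStat S a k = a j := by
  have hi : k - 1 < (Multiset.sort (S.val.map a) (· ≤ ·)).length := by
    rw [Multiset.length_sort]; simp; omega
  have hmem : ordStat S a k ∈ Multiset.sort (S.val.map a) (· ≤ ·) := by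
    unfold ordStat kthSmallest
    rw [List.getD_eq_getElem _ _ hi]; exact List.getElem_mem hi
  rw [Multiset.mem_sort, Multiset.mem_map] at hmem
  obtain ⟨j, hj, h⟩ := hmem
  exact ⟨j, hj, h.symm⟩

theorem Monotone.map_ordStat {ι : Type*} {S : Finset ι} {a : ι → ℝ} {g : ℝ → ℝ}
    (hg : Monotone g) {k : ℕ} (hk : 1 ≤ k) (hkS : k ≤ S.card) :
    g (ordStat S a k) = ordStat S (fun j => g (a j)) k := by
  unfold ordStat kthSmallest
  have hsort : (S.val.map fun j => g (a j)).sort (· ≤ ·)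
      = ((S.val.map a).sort (· ≤ ·)).map g := by
    refine List.Perm.eq_of_pairwise (le := (· ≤ ·)) (fun _ _ _ _ h h' => le_antisymm h h')
      (Multiset.pairwise_sort _ _)
      ((Multiset.pairwise_sort (S.val.map a) (· ≤ ·)).map g fun _ _ h => hg h) ?_
    rw [← Multiset.coe_eq_coe, Multiset.sort_eq, ← Multiset.map_coe, Multiset.sort_eq,
      Multiset.map_map]
    rfl
  have hi : k - 1 < (Multiset.sort (S.val.map a) (· ≤ ·)).length := by
    rw [Multiset.length_sort]; simp; omega
  rw [hsort, List.getD_eq_getElem _ _ hi, List.getD_eq_getElem _ _ (by simpa using hi)]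
  simp

theorem card_filter_eq_card_filter_erase {ι : Type*} [DecidableEq ι] {S : Finset ι} {j : ι}
    (hj : j ∈ S) (p : ι → Prop) [DecidablePred p] :
    (S.filter p).card = ((S.erase j).filter p).card + if p j then 1 else 0 := by
  conv_lhs => rw [← Finset.insert_erase hj]
  rw [Finset.filter_insert]
  split_ifs with h
  · rw [Finset.card_insert_of_notMem (by simp)]
  · simp

theorem ordStat_erase_of_le {ι : Type*} [DecidableEq ι] {S : Finset ι} {a : ι → ℝ} {k : ℕ}
    (hk : 1 ≤ k) {j : ι} (hj : j ∈ S) (hkS : k < S.card)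
    (h : k ≤ ((S.erase j).filter (a · ≤ a j)).card) :
    ordStat (S.erase j) a k = ordStat S a k := by
  refine eq_of_forall_ge_iff fun r => ?_
  rw [ordStat_le_iff hk (by rw [Finset.card_erase_of_mem hj]; omega), ordStat_le_iff hk hkS.le,
    card_filter_eq_card_filter_erase hj]
  split_ifs with hr
  · have : ((S.erase j).filter (a · ≤ a j)).card ≤ ((S.erase j).filter (a · ≤ r)).card :=
      Finset.card_le_card (Finset.monotone_filter_right _ fun l _ hl => le_trans hl hr)
    omega
  · simp

theorem ordStat_erase_of_lt {ι : Type*} [DecidableEq ι] {S : Finset ι} {a : ι → ℝ} {k : ℕ}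
    (hk : 1 ≤ k) {j : ι} (hj : j ∈ S) (hkS : k < S.card)
    (h : ((S.erase j).filter (a · ≤ a j)).card < k) :
    ordStat (S.erase j) a k = ordStat S a (k + 1) := by
  refine eq_of_forall_ge_iff fun r => ?_
  rw [ordStat_le_iff hk (by rw [Finset.card_erase_of_mem hj]; omega),
    ordStat_le_iff (by omega) hkS, card_filter_eq_card_filter_erase hj]
  split_ifs with hr
  · omega
  · have : ((S.erase j).filter (a · ≤ r)).card ≤ ((S.erase j).filter (a · ≤ a j)).card :=
      Finset.card_le_card (Finset.monotone_filter_right _ fun l _ hl =>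
        le_trans hl (not_le.1 hr).le)
    omega

theorem measurable_ordStat {Ω ι : Type*} [MeasurableSpace Ω] (S : Finset ι) {a : Ω → ι → ℝ}
    (ha : ∀ j ∈ S, Measurable fun ω => a ω j) {k : ℕ} (hk : 1 ≤ k) :
    Measurable fun ω => ordStat S (a ω) k := by
  classical
  by_cases hkS : k ≤ S.card
  · refine measurable_of_Iic fun r => ?_
    have : (fun ω => ordStat S (a ω) k) ⁻¹' Set.Iic r
        = ⋃ T ∈ S.powerset.filter (fun T => k ≤ T.card), ⋂ j ∈ T, {ω | a ω j ≤ r} := by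
      ext ω
      simp only [Set.mem_preimage, Set.mem_Iic, ordStat_le_iff hk hkS, Finset.mem_filter,
        Finset.mem_powerset, Set.mem_iUnion, Set.mem_iInter, Set.mem_ofPred_eq, exists_prop]
      constructor
      · intro h
        exact ⟨S.filter (a ω · ≤ r), ⟨Finset.filter_subset _ _, h⟩,
          fun j hj => (Finset.mem_filter.1 hj).2⟩
      · rintro ⟨T, ⟨hTS, hT⟩, h⟩
        exact hT.trans (Finset.card_le_card fun j hj => Finset.mem_filter.2 ⟨hTS hj, h j hj⟩)
    rw [this]
    refine Finset.measurableSet_biUnion _ fun T hT => Finset.measurableSet_biInter _ fun j hj => ?_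
    exact measurableSet_le (ha j ((Finset.mem_powerset.1 (Finset.mem_filter.1 hT).1) hj))
      measurable_const
  · have : (fun ω => ordStat S (a ω) k) = fun _ => 0 := by
      funext ω
      unfold ordStat kthSmallest
      rw [List.getD_eq_default]
      rw [Multiset.length_sort]; simp; omega
    rw [this]; exact measurable_const

/-! ### Counting nearest neighbours -/

/-- Euclidean space is covered by finitely many sets (narrow cones) in which subtracting the
shorter of two vectors does not lengthen the longer one. -/
theorem exists_finite_cone_cover (d : ℕ) :
    ∃ (M : ℕ) (c : Euc d → Fin M), ∀ u v : Euc d, c u = c v → ‖u‖ ≤ ‖v‖ → ‖v - u‖ ≤ ‖v‖ := by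
  classical
  have hcomp : IsCompact (Metric.closedBall (0 : Euc d) 1) := isCompact_closedBall _ _
  obtain ⟨t, -, ht, hcov⟩ := hcomp.finite_cover_balls (e := 1 / 2) (by norm_num)
  have hex : ∀ u : Euc d, ∃ p : t, ‖‖u‖⁻¹ • u - p‖ < 1 / 2 := by
    intro u
    have hu : ‖u‖⁻¹ • u ∈ Metric.closedBall (0 : Euc d) 1 := by
      rw [mem_closedBall_zero_iff, norm_smul, norm_inv, norm_norm]
      exact inv_mul_le_one
    obtain ⟨p, hp, hup⟩ := Set.mem_iUnion₂.1 (hcov hu)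
    exact ⟨⟨p, hp⟩, by simpa [dist_eq_norm] using hup⟩
  choose p hp using hex
  have : Fintype t := ht.fintype
  refine ⟨Fintype.card t, fun u => Fintype.equivFin t (p u), fun u v huv hle => ?_⟩
  have hpp : p u = p v := (Fintype.equivFin t).injective huv
  by_cases hu : u = 0
  · simp [hu]
  have hu0 : 0 < ‖u‖ := norm_pos_iff.2 hu
  have hv0 : 0 < ‖v‖ := hu0.trans_le hle
  have h1 : ‖‖v‖⁻¹ • v - ‖u‖⁻¹ • u‖ ≤ 1 := by
    have e : ‖v‖⁻¹ • v - ‖u‖⁻¹ • u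
        = (‖v‖⁻¹ • v - (p v : Euc d)) - (‖u‖⁻¹ • u - (p u : Euc d)) := by rw [hpp]; abel
    rw [e]
    exact (norm_sub_le _ _).trans (by linarith [hp u, hp v])
  have e : v - u = (‖v‖ - ‖u‖) • (‖v‖⁻¹ • v) + ‖u‖ • (‖v‖⁻¹ • v - ‖u‖⁻¹ • u) := by
    rw [smul_sub, sub_smul, smul_inv_smul₀ hv0.ne', smul_inv_smul₀ hu0.ne']; abel
  rw [e]
  refine (norm_add_le _ _).trans ?_
  rw [norm_smul, norm_smul, norm_smul, norm_inv, norm_norm, norm_norm, inv_mul_cancel₀ hv0.ne',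
    Real.norm_of_nonneg (sub_nonneg.2 hle)]
  nlinarith

theorem card_le_of_forall_card_filter_lt {ι : Type*} [DecidableEq ι] (T : Finset ι) (w : ι → ℝ)
    (k : ℕ) (h : ∀ i ∈ T, ((T.erase i).filter (w · ≤ w i)).card < k) : T.card ≤ k := by
  rcases T.eq_empty_or_nonempty with rfl | hT
  · simp
  obtain ⟨i, hi, hmax⟩ := T.exists_max_image w hT
  have := h i hi
  rw [Finset.filter_true_of_mem fun l hl => hmax l (Finset.mem_of_mem_erase hl),
    Finset.card_erase_of_mem hi] at this
  omega

end

noncomputable section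

/-! ### The torus distance -/

theorem torusDist_le (d : ℕ) (x y : Euc d) (m : Fin d → ℤ) :
    torusDist d x y ≤ ‖x + intVec d m - y‖ :=
  ciInf_le ⟨0, by rintro _ ⟨m, rfl⟩; exact norm_nonneg _⟩ m

theorem torusDist_nonneg (d : ℕ) (x y : Euc d) : 0 ≤ torusDist d x y :=
  le_ciInf fun _ => norm_nonneg _

@[simp] theorem intVec_apply (d : ℕ) (m : Fin d → ℤ) (i : Fin d) : intVec d m i = m i := rfl

theorem intVec_sub (d : ℕ) (m m' : Fin d → ℤ) : intVec d (m - m') = intVec d m - intVec d m' := by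
  ext i; simp

theorem torusDist_eq (d : ℕ) (x y : Euc d) :
    torusDist d x y = ‖x + intVec d (fun i => -round (x i - y i)) - y‖ := by
  refine le_antisymm (torusDist_le d x y _) (le_ciInf fun m => ?_)
  rw [EuclideanSpace.norm_eq, EuclideanSpace.norm_eq]
  refine Real.sqrt_le_sqrt (Finset.sum_le_sum fun i _ => ?_)
  have h := round_le (x i - y i) (-m i)
  simp only [PiLp.sub_apply, PiLp.add_apply, intVec_apply, Real.norm_eq_abs, Int.cast_neg] at h ⊢
  have e1 : x i + -(round (x i - y i) : ℝ) - y i = x i - y i - round (x i - y i) := by ring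
  have e2 : x i + (m i : ℝ) - y i = x i - y i - -(m i : ℝ) := by ring
  rw [e1, e2]
  gcongr

theorem torusDist_eq_sqrt (d : ℕ) (x y : Euc d) :
    torusDist d x y = √(∑ i, (x i - y i - round (x i - y i)) ^ 2) := by
  rw [torusDist_eq, EuclideanSpace.norm_eq]
  congr 1
  refine Finset.sum_congr rfl fun i _ => ?_
  simp only [PiLp.sub_apply, PiLp.add_apply, intVec_apply, Real.norm_eq_abs, Int.cast_neg, sq_abs]
  ring

theorem measurable_round_real : Measurable (round : ℝ → ℤ) := by
  have : (round : ℝ → ℤ) = fun x => ⌊x + 1 / 2⌋ := funext round_eq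
  rw [this]
  exact Int.measurable_floor.comp (measurable_id.add_const _)

theorem measurable_torusDist (d : ℕ) : Measurable fun p : Euc d × Euc d => torusDist d p.1 p.2 := by
  simp only [torusDist_eq_sqrt]
  refine Measurable.sqrt (Finset.measurable_sum _ fun i _ => ?_)
  have h : Measurable fun p : Euc d × Euc d => p.1 i - p.2 i := by fun_prop
  have h2 : Measurable fun p : Euc d × Euc d => ((round (p.1 i - p.2 i) : ℤ) : ℝ) :=
    (measurable_from_top (f := ((↑) : ℤ → ℝ))).comp (measurable_round_real.comp h)
  exact (h.sub h2).pow_const 2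

theorem torusDist_le_dim (d : ℕ) (x y : Euc d) : torusDist d x y ≤ d := by
  rw [torusDist_eq_sqrt]
  refine Real.sqrt_le_iff.2 ⟨by positivity, ?_⟩
  calc ∑ i, (x i - y i - round (x i - y i)) ^ 2 ≤ ∑ _i : Fin d, (1 : ℝ) := by
        refine Finset.sum_le_sum fun i _ => ?_
        have := abs_sub_round (x i - y i)
        rw [← sq_abs]
        nlinarith [abs_nonneg (x i - y i - round (x i - y i))]
    _ = d := by simp
    _ ≤ (d : ℝ) ^ 2 := by
        rcases Nat.eq_zero_or_pos d with h | h
        · simp [h]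
        · have : (1 : ℝ) ≤ d := by exact_mod_cast h
          nlinarith

theorem exists_torusDist_eq_norm (d : ℕ) (x y : Euc d) :
    ∃ m : Fin d → ℤ, torusDist d x y = ‖x + intVec d m - y‖ :=
  ⟨_, torusDist_eq d x y⟩

/-- A point is among the `k` nearest neighbours of boundedly many other points. -/
theorem exists_card_reverse_neighbours_le (d : ℕ) : ∃ M : ℕ, ∀ (n k : ℕ) (X : Fin n → Euc d)
    (j : Fin n), ((Finset.univ.erase j).filter fun i =>
      ((((Finset.univ.erase i).erase j).filter fun l =>
        torusDist d (X i) (X l) ≤ torusDist d (X i) (X j)).card < k)).card ≤ M * k := by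
  classical
  obtain ⟨M, c, hc⟩ := exists_finite_cone_cover d
  refine ⟨M, fun n k X j => ?_⟩
  choose m hm using fun i => exists_torusDist_eq_norm d (X i) (X j)
  set v : Fin n → Euc d := fun i => X i + intVec d (m i) - X j with hv
  set N := (Finset.univ.erase j).filter fun i =>
      ((((Finset.univ.erase i).erase j).filter fun l =>
        torusDist d (X i) (X l) ≤ torusDist d (X i) (X j)).card < k) with hN
  have hcard : N.card ≤ k * (Finset.univ : Finset (Fin M)).card := by
    refine Finset.card_le_mul_card_image_of_maps_to (f := fun i => c (v i))
      (fun _ _ => Finset.mem_univ _) k fun b _ => ?_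
    refine card_le_of_forall_card_filter_lt _ (fun i => ‖v i‖) k fun i hi => ?_
    rw [Finset.mem_filter] at hi
    have hiN := (Finset.mem_filter.1 hi.1).2
    refine lt_of_le_of_lt (Finset.card_le_card fun l hl => ?_) hiN
    simp only [Finset.mem_filter, Finset.mem_erase, Finset.mem_univ, and_true] at hl ⊢
    obtain ⟨⟨hli, hlN, hlb⟩, hle⟩ := hl
    have hlj : l ≠ j := by
      rw [hN, Finset.mem_filter, Finset.mem_erase] at hlN; exact hlN.1.1
    refine ⟨⟨hlj, hli⟩, ?_⟩
    calc torusDist d (X i) (X l) ≤ ‖X i + intVec d (m i - m l) - X l‖ := torusDist_le _ _ _ _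
      _ = ‖v i - v l‖ := by rw [intVec_sub, hv]; congr 1; module
      _ ≤ ‖v i‖ := hc _ _ (hlb.trans hi.2.symm) hle
      _ = torusDist d (X i) (X j) := (hm i).symm
  simpa [mul_comm] using hcard

/-! ### Removing one point -/

theorem nnDist_eq_ordStat (d n : ℕ) (X : Fin n → Euc d) (i : Fin n) (k : ℕ) :
    nnDist d n X i k = ordStat (Finset.univ.erase i) (fun j => torusDist d (X i) (X j)) k := rfl

/-- Deleting one sample point changes a sum over nearest-neighbour distances little in the
mean-square sense. -/
theorem exists_sum_sq_removal_le (d k : ℕ) (hk : 1 ≤ k) : ∃ C : ℝ, 0 ≤ C ∧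
    ∀ (n : ℕ), k + 1 < n → ∀ (g : ℝ → ℝ) (X : Fin n → Euc d),
      ∑ j, (∑ i, g (nnDist d n X i k) - ∑ i ∈ Finset.univ.erase j,
        g (ordStat ((Finset.univ.erase i).erase j) (fun l => torusDist d (X i) (X l)) k)) ^ 2
      ≤ C * ∑ i, (g (nnDist d n X i k) ^ 2 + g (nnDist d n X i (k + 1)) ^ 2) := by
  classical
  obtain ⟨M, hM⟩ := exists_card_reverse_neighbours_le d
  refine ⟨2 + 4 * (M * k) * k, by positivity, fun n hn g X => ?_⟩
  set P : Fin n → Fin n → Prop := fun i j => (((Finset.univ.erase i).erase j).filter fun l =>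
        torusDist d (X i) (X l) ≤ torusDist d (X i) (X j)).card < k with hP
  set D : Fin n → ℝ := fun i => g (nnDist d n X i k) - g (nnDist d n X i (k + 1)) with hD
  have key : ∀ j, (∑ i, g (nnDist d n X i k) - ∑ i ∈ Finset.univ.erase j,
      g (ordStat ((Finset.univ.erase i).erase j) (fun l => torusDist d (X i) (X l)) k))
      = g (nnDist d n X j k) + ∑ i ∈ (Finset.univ.erase j).filter (P · j), D i := by
    intro j
    rw [← Finset.add_sum_erase _ _ (Finset.mem_univ j), add_sub_assoc, ← Finset.sum_sub_distrib,
      Finset.sum_filter]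
    congr 1
    refine Finset.sum_congr rfl fun i hi => ?_
    have hji : j ∈ Finset.univ.erase i := by
      simpa using (Finset.ne_of_mem_erase hi).symm
    have hcard : k < (Finset.univ.erase i : Finset (Fin n)).card := by
      rw [Finset.card_erase_of_mem (Finset.mem_univ i)]; simp; omega
    split_ifs with h
    · rw [ordStat_erase_of_lt hk hji hcard h]; rfl
    · rw [ordStat_erase_of_le hk hji hcard (not_lt.1 h), nnDist_eq_ordStat, sub_self]
  have hk2 : ∀ i, ((Finset.univ.erase i).filter (P i ·)).card ≤ k := by
    intro i
    refine card_le_of_forall_card_filter_lt _ (fun l => torusDist d (X i) (X l)) k fun j hj => ?_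
    refine lt_of_le_of_lt (Finset.card_le_card fun l hl => ?_) (Finset.mem_filter.1 hj).2
    simp only [Finset.mem_filter, Finset.mem_erase, Finset.mem_univ, and_true] at hl ⊢
    exact ⟨⟨hl.1.1, hl.1.2.1⟩, hl.2⟩
  have hj : ∀ j, (g (nnDist d n X j k) + ∑ i ∈ (Finset.univ.erase j).filter (P · j), D i) ^ 2
      ≤ 2 * g (nnDist d n X j k) ^ 2
        + 2 * ((M * k) * ∑ i ∈ (Finset.univ.erase j).filter (P · j), D i ^ 2) := by
    intro j
    have h1 : (∑ i ∈ (Finset.univ.erase j).filter (P · j), D i) ^ 2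
        ≤ (M * k) * ∑ i ∈ (Finset.univ.erase j).filter (P · j), D i ^ 2 := by
      refine (sq_sum_le_card_mul_sum_sq).trans ?_
      have : (((Finset.univ.erase j).filter (P · j)).card : ℝ) ≤ M * k := by
        exact_mod_cast hM n k X j
      exact mul_le_mul_of_nonneg_right this (Finset.sum_nonneg fun _ _ => sq_nonneg _)
    nlinarith [sq_nonneg (g (nnDist d n X j k)
      - ∑ i ∈ (Finset.univ.erase j).filter (P · j), D i)]
  have hswap : ∑ j, ∑ i ∈ (Finset.univ.erase j).filter (P · j), D i ^ 2
      ≤ k * ∑ i, D i ^ 2 := by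
    have : ∑ j, ∑ i ∈ (Finset.univ.erase j).filter (P · j), D i ^ 2
        = ∑ i, ∑ _j ∈ (Finset.univ.erase i).filter (P i ·), D i ^ 2 := by
      refine Finset.sum_comm' fun j i => ?_
      simp [ne_comm]
    rw [this, Finset.mul_sum]
    refine Finset.sum_le_sum fun i _ => ?_
    rw [Finset.sum_const, nsmul_eq_mul]
    exact mul_le_mul_of_nonneg_right (by exact_mod_cast hk2 i) (sq_nonneg _)
  have hDle : ∑ i, D i ^ 2 ≤ 2 * ∑ i, (g (nnDist d n X i k) ^ 2 + g (nnDist d n X i (k + 1)) ^ 2) := by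
    rw [Finset.mul_sum]
    refine Finset.sum_le_sum fun i _ => ?_
    nlinarith [sq_nonneg (g (nnDist d n X i k) + g (nnDist d n X i (k + 1)))]
  have hg : ∑ i, g (nnDist d n X i k) ^ 2
      ≤ ∑ i, (g (nnDist d n X i k) ^ 2 + g (nnDist d n X i (k + 1)) ^ 2) :=
    Finset.sum_le_sum fun i _ => by nlinarith [sq_nonneg (g (nnDist d n X i (k + 1)))]
  simp only [key]
  refine (Finset.sum_le_sum fun j _ => hj j).trans ?_
  rw [Finset.sum_add_distrib, ← Finset.mul_sum, ← Finset.mul_sum, ← Finset.mul_sum]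
  have hMk : (0 : ℝ) ≤ M * k := by positivity
  have h2 := mul_le_mul_of_nonneg_left (hswap.trans
    (mul_le_mul_of_nonneg_left hDle (Nat.cast_nonneg k))) hMk
  nlinarith

end

noncomputable section

/-! ### The Efron–Stein inequality -/

theorem sq_integral_le {α : Type*} [MeasurableSpace α] {μ : Measure α} [IsProbabilityMeasure μ]
    {g : α → ℝ} (hg : MemLp g 2 μ) : (∫ x, g x ∂μ) ^ 2 ≤ ∫ x, g x ^ 2 ∂μ := by
  have h := ProbabilityTheory.variance_nonneg g μ
  rw [ProbabilityTheory.variance_eq_sub hg] at h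
  simpa using sub_nonneg.1 h

theorem integral_sub_sq_eq {α : Type*} [MeasurableSpace α] {μ : Measure α} {f g : α → ℝ}
    (hf : MemLp f 2 μ) (hg : MemLp g 2 μ) : ∫ x, (f x - g x) ^ 2 ∂μ
      = ∫ x, f x ^ 2 ∂μ - 2 * ∫ x, f x * g x ∂μ + ∫ x, g x ^ 2 ∂μ := by
  have h1 : Integrable (fun x => 2 * (f x * g x)) μ := (hf.integrable_mul hg).const_mul 2
  have h2 : Integrable (fun x => f x ^ 2 - 2 * (f x * g x)) μ := hf.integrable_sq.sub h1
  rw [← integral_const_mul, ← integral_sub hf.integrable_sq h1,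
    ← integral_add h2 hg.integrable_sq]
  congr 1; ext z; ring

section Prod
variable {α β : Type*} [MeasurableSpace α] [MeasurableSpace β] {μ : Measure α} {ν : Measure β}
  [IsProbabilityMeasure μ] [IsProbabilityMeasure ν] {Z : α × β → ℝ}

theorem ae_memLp_two_slice (hZ : MemLp Z 2 (μ.prod ν)) :
    ∀ᵐ y ∂ν, MemLp (fun x => Z (x, y)) 2 μ := by
  filter_upwards [(hZ.integrable one_le_two).prod_left_ae, hZ.integrable_sq.prod_left_ae]
    with y h1 h2
  exact (memLp_two_iff_integrable_sq h1.1).2 h2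

theorem memLp_two_integral_left (hZ : MemLp Z 2 (μ.prod ν)) :
    MemLp (fun y => ∫ x, Z (x, y) ∂μ) 2 ν := by
  have hi := (hZ.integrable one_le_two).integral_prod_right
  refine (memLp_two_iff_integrable_sq hi.1).2 ?_
  refine hZ.integrable_sq.integral_prod_right.mono' (hi.1.pow 2) ?_
  filter_upwards [ae_memLp_two_slice hZ] with y hy
  rw [Real.norm_of_nonneg (sq_nonneg _)]
  exact sq_integral_le hy

theorem integral_sq_integral_left_le (hZ : MemLp Z 2 (μ.prod ν)) :
    ∫ y, (∫ x, Z (x, y) ∂μ) ^ 2 ∂ν ≤ ∫ z, Z z ^ 2 ∂(μ.prod ν) := by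
  rw [integral_prod_symm _ hZ.integrable_sq]
  refine integral_mono_ae (memLp_two_integral_left hZ).integrable_sq
    hZ.integrable_sq.integral_prod_right ?_
  filter_upwards [ae_memLp_two_slice hZ] with y hy
  exact sq_integral_le hy

theorem variance_prod_le (hZ : MemLp Z 2 (μ.prod ν)) {z₀ : β → ℝ} (h₀ : MemLp z₀ 2 ν) :
    ProbabilityTheory.variance Z (μ.prod ν) ≤ ∫ z, (Z z - z₀ z.2) ^ 2 ∂(μ.prod ν)
      + ProbabilityTheory.variance (fun y => ∫ x, Z (x, y) ∂μ) ν := by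
  set W : β → ℝ := fun y => ∫ x, Z (x, y) ∂μ with hWdef
  have hW : MemLp W 2 ν := memLp_two_integral_left hZ
  have hmp : MeasurePreserving (Prod.snd : α × β → β) (μ.prod ν) ν := measurePreserving_snd
  have h₀' : MemLp (fun z : α × β => z₀ z.2) 2 (μ.prod ν) := h₀.comp_measurePreserving hmp
  have hZz : Integrable (fun z => Z z * z₀ z.2) (μ.prod ν) := hZ.integrable_mul h₀'
  have hWz : Integrable (fun y => W y * z₀ y) ν := hW.integrable_mul h₀
  have e1 : ∫ z, Z z * z₀ z.2 ∂(μ.prod ν) = ∫ y, W y * z₀ y ∂ν := by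
    rw [integral_prod_symm _ hZz]
    simp only [integral_mul_const, hWdef]
  have e2 : ∫ z, z₀ z.2 ^ 2 ∂(μ.prod ν) = ∫ y, z₀ y ^ 2 ∂ν := by
    rw [integral_prod_symm _ h₀'.integrable_sq]; simp
  have e3 : ∫ z, Z z ∂(μ.prod ν) = ∫ y, W y ∂ν :=
    integral_prod_symm _ (hZ.integrable one_le_two)
  have e4 : ∫ z, (Z z - z₀ z.2) ^ 2 ∂(μ.prod ν)
      = ∫ z, Z z ^ 2 ∂(μ.prod ν) - 2 * ∫ y, W y * z₀ y ∂ν + ∫ y, z₀ y ^ 2 ∂ν := by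
    rw [← e1, ← e2]; exact integral_sub_sq_eq hZ h₀'
  have e5 : ∫ y, (W y - z₀ y) ^ 2 ∂ν
      = ∫ y, W y ^ 2 ∂ν - 2 * ∫ y, W y * z₀ y ∂ν + ∫ y, z₀ y ^ 2 ∂ν :=
    integral_sub_sq_eq hW h₀
  have h5 : 0 ≤ ∫ y, (W y - z₀ y) ^ 2 ∂ν := integral_nonneg fun _ => sq_nonneg _
  rw [ProbabilityTheory.variance_eq_sub hZ, ProbabilityTheory.variance_eq_sub hW]
  simp only [Pi.pow_apply]
  rw [e3]
  linarith

end Prod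

/-- **Efron–Stein inequality**: the variance of a function of independent variables is at most the
sum of its mean-square distances to functions that ignore one of the variables. -/
theorem variance_pi_le_sum {E : Type*} [MeasurableSpace E] (μ : Measure E) [IsProbabilityMeasure μ]
    (n : ℕ) (Z : (Fin n → E) → ℝ) (Z' : Fin n → (Fin n → E) → ℝ)
    (hZ : MemLp Z 2 (Measure.pi fun _ => μ)) (hZ' : ∀ i, MemLp (Z' i) 2 (Measure.pi fun _ => μ))
    (hind : ∀ i X y, Z' i (Function.update X i y) = Z' i X) :
    ProbabilityTheory.variance Z (Measure.pi fun _ => μ)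
      ≤ ∑ i, ∫ X, (Z X - Z' i X) ^ 2 ∂(Measure.pi fun _ => μ) := by
  induction n with
  | zero =>
    have : Z = fun _ => Z default := by funext X; rw [Subsingleton.elim X default]
    rw [this, ProbabilityTheory.variance_eq_sub (memLp_const _)]
    simp
  | succ n ih =>
    set ν : Measure (Fin n → E) := Measure.pi fun _ => μ with hν
    set e := MeasurableEquiv.piFinSuccAbove (fun _ : Fin (n + 1) => E) 0 with he
    have hmp : MeasurePreserving e.symm (μ.prod ν) (Measure.pi fun _ => μ) :=
      (measurePreserving_piFinSuccAbove (fun _ : Fin (n + 1) => μ) 0).symm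
    have hsymm : ∀ p : E × (Fin n → E), e.symm p = Fin.cons p.1 p.2 := by
      intro p
      simp [he, MeasurableEquiv.piFinSuccAbove_symm_apply, Fin.insertNthEquiv]
    have hZe : MemLp (fun p => Z (e.symm p)) 2 (μ.prod ν) := hZ.comp_measurePreserving hmp
    have hZe' : ∀ i, MemLp (fun p => Z' i (e.symm p)) 2 (μ.prod ν) :=
      fun i => (hZ' i).comp_measurePreserving hmp
    have hint : ∀ g : (Fin (n + 1) → E) → ℝ,
        ∫ X, g X ∂(Measure.pi fun _ => μ) = ∫ p, g (e.symm p) ∂(μ.prod ν) :=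
      fun g => (hmp.integral_comp' g).symm
    have hvar : ProbabilityTheory.variance Z (Measure.pi fun _ => μ)
        = ProbabilityTheory.variance (fun p => Z (e.symm p)) (μ.prod ν) := by
      rw [ProbabilityTheory.variance_eq_sub hZ, ProbabilityTheory.variance_eq_sub hZe]
      simp only [Pi.pow_apply]
      rw [hint, hint]
    have hnon : Nonempty E := μ.nonempty_of_neZero
    set x₀ : E := Classical.arbitrary E
    have hz0 : ∀ p : E × (Fin n → E), Z' 0 (e.symm p) = Z' 0 (Fin.cons x₀ p.2) := by
      intro p
      rw [hsymm, ← hind 0 (Fin.cons p.1 p.2) x₀, Fin.update_cons_zero]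
    have h₀ : MemLp (fun y : Fin n → E => Z' 0 (Fin.cons x₀ y)) 2 ν := by
      have h := ae_memLp_two_slice (Z := fun q : (Fin n → E) × E => Z' 0 (e.symm q.swap)) (μ := ν)
        (ν := μ) ((hZe' 0).comp_measurePreserving Measure.measurePreserving_swap)
      obtain ⟨x, hx⟩ := h.exists
      refine hx.congr_norm ?_ (Filter.Eventually.of_forall fun y => ?_)
      · have := hx.1
        simpa only [Prod.swap_prod_mk, hz0] using this
      · simp only [Prod.swap_prod_mk, hz0]
    rw [hvar, Fin.sum_univ_succ]
    refine (variance_prod_le hZe h₀).trans (add_le_add ?_ ?_)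
    · rw [hint]; simp only [hz0]; exact le_rfl
    · refine (ih (fun y => ∫ x, Z (e.symm (x, y)) ∂μ)
        (fun i y => ∫ x, Z' i.succ (e.symm (x, y)) ∂μ) (memLp_two_integral_left hZe)
        (fun i => memLp_two_integral_left (hZe' i.succ)) ?_).trans ?_
      · intro i X y
        refine integral_congr_ae (Filter.Eventually.of_forall fun x => ?_)
        simp only [hsymm]
        rw [Fin.cons_update, hind]
      · refine Finset.sum_le_sum fun i _ => ?_
        rw [hint]
        refine le_trans (le_of_eq ?_) (integral_sq_integral_left_le (hZe.sub (hZe' i.succ)))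
        refine integral_congr_ae ?_
        filter_upwards [ae_memLp_two_slice hZe, ae_memLp_two_slice (hZe' i.succ)] with y h1 h2
        rw [← integral_sub (h1.integrable one_le_two) (h2.integrable one_le_two)]

end

noncomputable section

/-! ### The law of a uniform order statistic -/

section Beta
open Polynomial

/-- The polynomial `u ↦ P(Bin(p + 1, u) ≥ q + 1)`. -/
def binomialTail (p q : ℕ) : ℝ[X] :=
  ∑ j ∈ Finset.Ico (q + 1) (p + 2), bernsteinPolynomial ℝ (p + 1) j

theorem derivative_binomialTail {p q : ℕ} (hq : q ≤ p) :
    derivative (binomialTail p q) = ((p : ℝ[X]) + 1) * bernsteinPolynomial ℝ p q := by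
  have h : binomialTail p q = ∑ i ∈ Finset.Ico q (p + 1), bernsteinPolynomial ℝ (p + 1) (i + 1) := by
    rw [binomialTail, Finset.sum_Ico_add']
  rw [h, derivative_sum]
  simp only [bernsteinPolynomial.derivative_succ, Nat.add_sub_cancel, ← Finset.mul_sum]
  have := Finset.sum_Ico_sub (fun i => bernsteinPolynomial ℝ p i) (show q ≤ p + 1 by omega)
  have h2 : ∑ i ∈ Finset.Ico q (p + 1),
      (bernsteinPolynomial ℝ p i - bernsteinPolynomial ℝ p (i + 1)) = bernsteinPolynomial ℝ p q := by
    rw [← neg_inj, ← Finset.sum_neg_distrib]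
    simp only [neg_sub]
    rw [this, bernsteinPolynomial.eq_zero_of_lt ℝ (Nat.lt_succ_self p)]; simp
  rw [h2]; push_cast; rfl

theorem binomialTail_eval_zero (p q : ℕ) : (binomialTail p q).eval 0 = 0 := by
  rw [binomialTail, eval_finsetSum]
  refine Finset.sum_eq_zero fun j hj => ?_
  rw [bernsteinPolynomial.eval_at_0, if_neg]
  have := (Finset.mem_Ico.1 hj).1; omega

theorem binomialTail_eval_one {p q : ℕ} (hq : q ≤ p) : (binomialTail p q).eval 1 = 1 := by
  rw [binomialTail, eval_finsetSum]
  simp only [bernsteinPolynomial.eval_at_1]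
  rw [Finset.sum_ite_eq' , if_pos]
  rw [Finset.mem_Ico]; omega

theorem bernstein_eval (p q : ℕ) (u : ℝ) :
    (bernsteinPolynomial ℝ p q).eval u = p.choose q * u ^ q * (1 - u) ^ (p - q) := by
  simp [bernsteinPolynomial]

theorem bernstein_eval_nonneg (p q : ℕ) {u : ℝ} (h0 : 0 ≤ u) (h1 : u ≤ 1) :
    0 ≤ (bernsteinPolynomial ℝ p q).eval u := by
  rw [bernstein_eval]
  have : 0 ≤ 1 - u := by linarith
  positivity

theorem integral_bernstein_eq_tail {p q : ℕ} (hq : q ≤ p) (u : ℝ) :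
    ∫ t in (0 : ℝ)..u, ((p : ℝ) + 1) * (bernsteinPolynomial ℝ p q).eval t
      = (binomialTail p q).eval u := by
  have h := intervalIntegral.integral_eq_sub_of_hasDerivAt (a := 0) (b := u)
    (f := fun t => (binomialTail p q).eval t)
    (f' := fun t => ((p : ℝ) + 1) * (bernsteinPolynomial ℝ p q).eval t)
    (fun t _ => by
      have := (binomialTail p q).hasDerivAt t
      rw [derivative_binomialTail hq] at this
      simpa using this)
    ((by fun_prop : Continuous _).intervalIntegrable _ _)
  rw [h, binomialTail_eval_zero, sub_zero]

theorem integral_bernstein {p q : ℕ} (hq : q ≤ p) :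
    ∫ t in (0 : ℝ)..1, (bernsteinPolynomial ℝ p q).eval t = 1 / ((p : ℝ) + 1) := by
  have h := integral_bernstein_eq_tail hq 1
  rw [binomialTail_eval_one hq, intervalIntegral.integral_const_mul] at h
  have : (0 : ℝ) < p + 1 := by positivity
  field_simp
  linarith

theorem intervalIntegrable_log_mul_eval (P : ℝ[X]) :
    IntervalIntegrable (fun u => log u * P.eval u) volume 0 1 :=
  intervalIntegral.intervalIntegrable_log'.mul_continuousOn (P.continuous.continuousOn)

theorem integral_log_mul_derivative (Q : ℝ[X]) :
    ∫ u in (0 : ℝ)..1, log u * (derivative (X * Q)).eval u = -∫ u in (0 : ℝ)..1, Q.eval u := by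
  have hQ : IntervalIntegrable (fun u => Q.eval u) volume 0 1 := Q.continuous.intervalIntegrable _ _
  have hl := intervalIntegrable_log_mul_eval (derivative (X * Q))
  have h := intervalIntegral.integral_eq_sub_of_hasDerivAt_of_le (a := 0) (b := 1)
    (f := fun u => u * log u * Q.eval u)
    (f' := fun u => log u * (derivative (X * Q)).eval u + Q.eval u) zero_le_one
    ((Real.continuous_mul_log.mul Q.continuous).continuousOn)
    (fun u hu => by
      have h1 := (Real.hasDerivAt_log hu.1.ne').mul ((X * Q).hasDerivAt u)
      have h2 : (fun u => u * log u * Q.eval u) = log * fun u => (X * Q).eval u := by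
        ext u; simp; ring
      rw [h2]
      refine h1.congr_deriv ?_
      rw [eval_mul, eval_X, inv_mul_cancel_left₀ hu.1.ne', add_comm]) (hl.add hQ)
  rw [intervalIntegral.integral_add hl hQ] at h
  simp only [log_one, mul_zero, zero_mul, sub_zero] at h
  linarith

theorem binomialTail_eq_X_mul {p q : ℕ} : binomialTail p q
    = X * ∑ i ∈ Finset.Ico q (p + 1), C (((p : ℝ) + 1) / (i + 1)) * bernsteinPolynomial ℝ p i := by
  have h : binomialTail p q = ∑ i ∈ Finset.Ico q (p + 1), bernsteinPolynomial ℝ (p + 1) (i + 1) := by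
    rw [binomialTail, Finset.sum_Ico_add']
  rw [h, Finset.mul_sum]
  refine Finset.sum_congr rfl fun i _ => ?_
  have hc : ((p + 1).choose (i + 1) : ℝ) = ((p : ℝ) + 1) / (i + 1) * p.choose i := by
    have h := Nat.add_one_mul_choose_eq p i
    have h' : ((p : ℝ) + 1) * p.choose i = (p + 1).choose (i + 1) * (i + 1) := by exact_mod_cast h
    field_simp
    linarith
  rw [bernsteinPolynomial, bernsteinPolynomial, ← C_eq_natCast, hc, ← C_eq_natCast, C_mul,
    Nat.add_sub_add_right]
  ring

theorem integral_log_mul_bernstein {p q : ℕ} (hq : q ≤ p) :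
    ∫ u in (0 : ℝ)..1, log u * (((p : ℝ) + 1) * (bernsteinPolynomial ℝ p q).eval u)
      = harmonic q - harmonic (p + 1) := by
  have h := integral_log_mul_derivative (∑ i ∈ Finset.Ico q (p + 1),
    C (((p : ℝ) + 1) / (i + 1)) * bernsteinPolynomial ℝ p i)
  rw [← binomialTail_eq_X_mul, derivative_binomialTail hq] at h
  simp only [eval_mul, eval_add, eval_natCast, eval_one, eval_finsetSum, eval_C] at h
  rw [h, intervalIntegral.integral_finsetSum fun i _ =>
    (by fun_prop : Continuous _).intervalIntegrable _ _]
  have h2 : ∀ i ∈ Finset.Ico q (p + 1), ∫ u in (0 : ℝ)..1,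
      ((p : ℝ) + 1) / (i + 1) * (bernsteinPolynomial ℝ p i).eval u = 1 / ((i : ℝ) + 1) := by
    intro i hi
    rw [intervalIntegral.integral_const_mul, integral_bernstein (by
      have := (Finset.mem_Ico.1 hi).2; omega)]
    have : (p : ℝ) + 1 ≠ 0 := by positivity
    field_simp
  rw [Finset.sum_congr rfl h2, Finset.sum_Ico_eq_sub _ (by omega), harmonic, harmonic]
  push_cast
  simp only [one_div]
  ring

/-- The law of the `(q + 1)`-st smallest of `p + 1` independent uniform variables. -/
def betaLaw (p q : ℕ) : Measure ℝ := (volume.restrict (Set.Ioc 0 1)).withDensity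
  fun u => ENNReal.ofReal (((p : ℝ) + 1) * (bernsteinPolynomial ℝ p q).eval u)

theorem measurable_betaDensity (p q : ℕ) :
    Measurable fun u : ℝ => ENNReal.ofReal (((p : ℝ) + 1) * (bernsteinPolynomial ℝ p q).eval u) :=
  ENNReal.measurable_ofReal.comp (by fun_prop : Continuous _).measurable

theorem ae_toReal_betaDensity (p q : ℕ) : ∀ᵐ u : ℝ ∂(volume.restrict (Set.Ioc (0 : ℝ) 1)),
    (ENNReal.ofReal (((p : ℝ) + 1) * (bernsteinPolynomial ℝ p q).eval u)).toReal
      = ((p : ℝ) + 1) * (bernsteinPolynomial ℝ p q).eval u := by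
  filter_upwards [ae_restrict_mem measurableSet_Ioc] with u hu
  exact ENNReal.toReal_ofReal (mul_nonneg (by positivity) (bernstein_eval_nonneg p q hu.1.le hu.2))

theorem betaLaw_Iic {p q : ℕ} (hq : q ≤ p) {u : ℝ} (h0 : 0 ≤ u) (h1 : u ≤ 1) :
    betaLaw p q (Set.Iic u) = ENNReal.ofReal ((binomialTail p q).eval u) := by
  rw [betaLaw, withDensity_apply _ measurableSet_Iic, Measure.restrict_restrict measurableSet_Iic,
    ← integral_bernstein_eq_tail hq u, intervalIntegral.integral_of_le h0,
    ofReal_integral_eq_lintegral_ofReal]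
  · congr 2
    ext x
    simp only [Set.mem_inter_iff, Set.mem_Iic, Set.mem_Ioc]
    constructor
    · rintro ⟨a, b, c⟩; exact ⟨b, a⟩
    · rintro ⟨a, b⟩; exact ⟨b, a, b.trans h1⟩
  · exact ((by fun_prop : Continuous _).intervalIntegrable 0 u).1
  · filter_upwards [ae_restrict_mem measurableSet_Ioc] with x hx
    exact mul_nonneg (by positivity) (bernstein_eval_nonneg p q hx.1.le (hx.2.trans h1))

theorem betaLaw_univ {p q : ℕ} (hq : q ≤ p) : betaLaw p q Set.univ = 1 := by
  have h := betaLaw_Iic hq zero_le_one le_rfl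
  rw [binomialTail_eval_one hq, ENNReal.ofReal_one] at h
  rw [← h, betaLaw, withDensity_apply _ MeasurableSet.univ, withDensity_apply _ measurableSet_Iic,
    Measure.restrict_restrict measurableSet_Iic, Measure.restrict_univ]
  congr 2
  ext x; simp

theorem integral_log_betaLaw {p q : ℕ} (hq : q ≤ p) :
    ∫ u, log u ∂(betaLaw p q) = harmonic q - harmonic (p + 1) := by
  rw [betaLaw, integral_withDensity_eq_integral_toReal_smul (measurable_betaDensity p q)
    (Filter.Eventually.of_forall fun _ => ENNReal.ofReal_lt_top), ← integral_log_mul_bernstein hq,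
    intervalIntegral.integral_of_le zero_le_one]
  refine integral_congr_ae ?_
  filter_upwards [ae_toReal_betaDensity p q] with u hu
  rw [hu, smul_eq_mul, mul_comm]

theorem integrable_log_betaLaw (p q : ℕ) : Integrable log (betaLaw p q) := by
  rw [betaLaw, integrable_withDensity_iff (measurable_betaDensity p q)
    (Filter.Eventually.of_forall fun _ => ENNReal.ofReal_lt_top)]
  have := (intervalIntegrable_log_mul_eval ((C ((p : ℝ) + 1)) * bernsteinPolynomial ℝ p q)).1
  refine Integrable.congr this ?_
  filter_upwards [ae_toReal_betaDensity p q] with u hu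
  rw [hu]; simp

theorem lintegral_betaLaw (p q : ℕ) {g : ℝ → ℝ} (hg : Measurable g) :
    ∫⁻ u, ENNReal.ofReal (g u) ∂(betaLaw p q) = ∫⁻ u in Set.Ioc 0 1,
      ENNReal.ofReal (((p : ℝ) + 1) * (bernsteinPolynomial ℝ p q).eval u * g u) := by
  rw [betaLaw, lintegral_withDensity_eq_lintegral_mul _ (measurable_betaDensity p q)
    hg.ennreal_ofReal]
  refine setLIntegral_congr_fun measurableSet_Ioc fun u hu => ?_
  simp only [Pi.mul_apply]
  rw [ENNReal.ofReal_mul (mul_nonneg (by positivity) (bernstein_eval_nonneg p q hu.1.le hu.2))]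

theorem lintegral_sq_bernstein_le {p q : ℕ} (hq : q ≤ p) :
    ∫⁻ u in Set.Ioc (0 : ℝ) 1, ENNReal.ofReal
      (((p : ℝ) + 1) * (bernsteinPolynomial ℝ p q).eval u * (((p : ℝ) + 2) * u) ^ 2)
      ≤ ENNReal.ofReal (((q : ℝ) + 1) * (q + 2)) := by
  have hc : ∀ u : ℝ, ((p : ℝ) + 1) * (bernsteinPolynomial ℝ p q).eval u * (((p : ℝ) + 2) * u) ^ 2
      = ((p : ℝ) + 2) * ((q : ℝ) + 1) * (q + 2) * (bernsteinPolynomial ℝ (p + 2) (q + 2)).eval u := by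
    intro u
    have h1 : ((p : ℝ) + 1) * p.choose q = (p + 1).choose (q + 1) * (q + 1) := by
      exact_mod_cast Nat.add_one_mul_choose_eq p q
    have h2 : ((p : ℝ) + 1 + 1) * (p + 1).choose (q + 1)
        = (p + 1 + 1).choose (q + 1 + 1) * (q + 1 + 1) := by
      exact_mod_cast Nat.add_one_mul_choose_eq (p + 1) (q + 1)
    rw [bernstein_eval, bernstein_eval, show p + 2 - (q + 2) = p - q by omega]
    calc _ = (((p : ℝ) + 1) * p.choose q) * ((p : ℝ) + 2) ^ 2 * u ^ (q + 2) * (1 - u) ^ (p - q) := by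
          ring
      _ = (((p : ℝ) + 1 + 1) * (p + 1).choose (q + 1)) * (q + 1) * ((p : ℝ) + 2) * u ^ (q + 2)
          * (1 - u) ^ (p - q) := by rw [h1]; ring
      _ = _ := by rw [h2]; ring
  simp only [hc]
  rw [← ofReal_integral_eq_lintegral_ofReal
    ((by fun_prop : Continuous _).intervalIntegrable 0 1).1]
  · refine ENNReal.ofReal_le_ofReal ?_
    rw [← intervalIntegral.integral_of_le zero_le_one, intervalIntegral.integral_const_mul,
      integral_bernstein (by omega)]
    push_cast
    rw [mul_one_div, div_le_iff₀ (by positivity)]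
    have : 0 ≤ ((q : ℝ) + 1) * (q + 2) := by positivity
    nlinarith
  · filter_upwards [ae_restrict_mem measurableSet_Ioc] with u hu
    exact mul_nonneg (by positivity) (bernstein_eval_nonneg _ _ hu.1.le hu.2)

theorem lintegral_sq_betaLaw_le {p q : ℕ} (hq : q ≤ p) :
    ∫⁻ u, ENNReal.ofReal ((((p : ℝ) + 2) * u) ^ 2) ∂(betaLaw p q)
      ≤ ENNReal.ofReal (((q : ℝ) + 1) * (q + 2)) := by
  rw [lintegral_betaLaw _ _ (by fun_prop)]
  exact lintegral_sq_bernstein_le hq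

theorem log_sq_le_rpow {x : ℝ} (h0 : 0 < x) (h1 : x ≤ 1) :
    log x ^ 2 ≤ 16 * x ^ (-(1 / 2) : ℝ) := by
  have h := abs_log_mul_self_rpow_lt x (1 / 4) h0 h1 (by norm_num)
  have h' : |log x * x ^ (1 / 4 : ℝ)| < 4 := h.trans_eq (by norm_num)
  have h2 : (log x * x ^ (1 / 4 : ℝ)) ^ 2 ≤ 16 := by
    rw [← sq_abs]; nlinarith [abs_nonneg (log x * x ^ (1 / 4 : ℝ))]
  have h3 : (x ^ (1 / 4 : ℝ)) ^ 2 = x ^ (1 / 2 : ℝ) := by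
    rw [← rpow_natCast, ← rpow_mul h0.le]; norm_num
  rw [mul_pow, h3] at h2
  rw [rpow_neg h0.le, ← div_eq_mul_inv, le_div_iff₀ (by positivity)]
  exact h2

theorem log_sq_le_sq {x : ℝ} (h1 : 1 ≤ x) : log x ^ 2 ≤ x ^ 2 := by
  have := Real.log_le_sub_one_of_pos (by linarith : 0 < x)
  have := Real.log_nonneg h1
  nlinarith

theorem bernstein_le_one {p q : ℕ} {u : ℝ} (h0 : 0 ≤ u) (h1 : ((p : ℝ) + 2) * u ≤ 1) :
    (bernsteinPolynomial ℝ p q).eval u ≤ 1 := by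
  rw [bernstein_eval]
  have hp : (0 : ℝ) ≤ p := by positivity
  have hpu' : 0 ≤ (p : ℝ) * u := by positivity
  have hu1 : u ≤ 1 := by linarith
  have hpu : (p : ℝ) * u ≤ 1 := by linarith
  have hu2 : (0 : ℝ) ≤ 1 - u := by linarith
  have hc : (p.choose q : ℝ) ≤ (p : ℝ) ^ q := by exact_mod_cast Nat.choose_le_pow p q
  calc (p.choose q : ℝ) * u ^ q * (1 - u) ^ (p - q) ≤ (p : ℝ) ^ q * u ^ q * 1 := by
        gcongr
        exact pow_le_one₀ hu2 (by linarith)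
    _ = ((p : ℝ) * u) ^ q := by rw [mul_pow, mul_one]
    _ ≤ 1 := pow_le_one₀ (by positivity) hpu

theorem lintegral_log_sq_betaLaw_le {p q : ℕ} (hq : q ≤ p) :
    ∫⁻ u, ENNReal.ofReal (log (((p : ℝ) + 2) * u) ^ 2) ∂(betaLaw p q)
      ≤ ENNReal.ofReal (32 + ((q : ℝ) + 1) * (q + 2)) := by
  have hn : (0 : ℝ) < (p : ℝ) + 2 := by positivity
  set n : ℝ := (p : ℝ) + 2 with hndef
  have hn1 : 1 / n ≤ 1 := by rw [div_le_one hn, hndef]; linarith [Nat.cast_nonneg (α := ℝ) p]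
  have hn0 : 0 ≤ 1 / n := by positivity
  have hm : Measurable fun u : ℝ => log (n * u) ^ 2 :=
    (Real.measurable_log.comp (measurable_const_mul n)).pow_const 2
  rw [lintegral_betaLaw _ _ hm,
    ← Set.Ioc_union_Ioc_eq_Ioc hn0 hn1,
    lintegral_union measurableSet_Ioc (Set.Ioc_disjoint_Ioc_of_le le_rfl),
    ENNReal.ofReal_add (by norm_num) (by positivity)]
  refine add_le_add ?_ ?_
  · have hint : IntervalIntegrable (fun u : ℝ => 16 * n * n ^ (-(1 / 2) : ℝ) * u ^ (-(1 / 2) : ℝ))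
        volume 0 (1 / n) := (intervalIntegral.intervalIntegrable_rpow' (by norm_num)).const_mul _
    have heval : ∫ u in (0 : ℝ)..(1 / n), 16 * n * n ^ (-(1 / 2) : ℝ) * u ^ (-(1 / 2) : ℝ) = 32 := by
      rw [intervalIntegral.integral_const_mul, integral_rpow (Or.inl (by norm_num))]
      norm_num
      rw [inv_rpow hn.le, rpow_neg hn.le]
      have h : n ^ (1 / 2 : ℝ) * n ^ (1 / 2 : ℝ) = n := by
        rw [← rpow_add hn]; norm_num
      have h0 : n ^ (1 / 2 : ℝ) ≠ 0 := (rpow_pos_of_pos hn _).ne'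
      field_simp
      nlinarith
    rw [← heval, intervalIntegral.integral_of_le hn0, ofReal_integral_eq_lintegral_ofReal hint.1]
    · refine setLIntegral_mono' measurableSet_Ioc fun u hu => ENNReal.ofReal_le_ofReal ?_
      have hnu : n * u ≤ 1 := by rw [mul_comm]; exact (le_div_iff₀ hn).1 hu.2
      have hb := bernstein_le_one (q := q) hu.1.le hnu
      have hl := log_sq_le_rpow (mul_pos hn hu.1) hnu
      rw [mul_rpow hn.le hu.1.le] at hl
      have hb0 := bernstein_eval_nonneg p q hu.1.le (hu.2.trans hn1)
      have h1 : ((p : ℝ) + 1) * (bernsteinPolynomial ℝ p q).eval u ≤ n := by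
        rw [hndef]; nlinarith [Nat.cast_nonneg (α := ℝ) p]
      calc _ ≤ n * (16 * (n ^ (-(1 / 2) : ℝ) * u ^ (-(1 / 2) : ℝ))) := by gcongr
        _ = _ := by ring
    · filter_upwards [ae_restrict_mem measurableSet_Ioc] with u hu
      have := hu.1
      simp only [Pi.zero_apply]
      positivity
  · refine le_trans ?_ (lintegral_sq_bernstein_le hq)
    refine le_trans (setLIntegral_mono' measurableSet_Ioc fun u hu => ENNReal.ofReal_le_ofReal ?_)
      (lintegral_mono_set (Set.Ioc_subset_Ioc_left hn0))
    have hnu : 1 ≤ n * u := by rw [mul_comm]; exact ((div_lt_iff₀ hn).1 hu.1).le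
    have hb0 := bernstein_eval_nonneg p q (hn0.trans hu.1.le) hu.2
    exact mul_le_mul_of_nonneg_left (log_sq_le_sq hnu) (by positivity)

end Beta

end

noncomputable section

/-! ### Law of the mass of a nearest neighbour ball -/

theorem continuous_cdf (ν : Measure ℝ) [IsProbabilityMeasure ν] [NullSingletonClass ν] :
    Continuous (ProbabilityTheory.cdf ν) := by
  rw [continuous_iff_continuousAt]
  intro a
  refine continuousAt_iff_continuous_left'_right'.2 ⟨?_, ?_⟩
  · rw [(ProbabilityTheory.monotone_cdf ν).continuousWithinAt_Iio_iff_leftLim_eq]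
    have h := (ProbabilityTheory.cdf ν).measure_singleton a
    rw [ProbabilityTheory.measure_cdf, measure_singleton, eq_comm, ENNReal.ofReal_eq_zero] at h
    exact le_antisymm ((ProbabilityTheory.monotone_cdf ν).leftLim_le le_rfl) (by linarith)
  · exact ((ProbabilityTheory.cdf ν).right_continuous a).mono Set.Ioi_subset_Ici_self

theorem exists_cdf_eq (ν : Measure ℝ) [IsProbabilityMeasure ν] [NullSingletonClass ν] {u : ℝ} (h0 : 0 < u)
    (h1 : u < 1) : ∃ r, ProbabilityTheory.cdf ν r = u := by
  obtain ⟨a, ha⟩ := ((ProbabilityTheory.tendsto_cdf_atBot ν).eventually_lt_const h0).exists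
  obtain ⟨b, hb⟩ := ((ProbabilityTheory.tendsto_cdf_atTop ν).eventually_const_lt h1).exists
  exact mem_range_of_exists_le_of_exists_ge (continuous_cdf ν) ⟨a, ha.le⟩ ⟨b, hb.le⟩

/-- The probability integral transform. -/
theorem measureReal_cdf_le (ν : Measure ℝ) [IsProbabilityMeasure ν] [NullSingletonClass ν] {u : ℝ}
    (h0 : 0 ≤ u) (h1 : u ≤ 1) : ν.real {x | ProbabilityTheory.cdf ν x ≤ u} = u := by
  rcases h1.eq_or_lt with rfl | h1
  · have : {x | ProbabilityTheory.cdf ν x ≤ 1} = Set.univ :=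
      Set.eq_univ_of_forall (ProbabilityTheory.cdf_le_one ν)
    rw [this, probReal_univ]
  refine le_antisymm (le_of_forall_gt_imp_ge_of_dense fun v hv => ?_) ?_
  · rcases le_or_gt 1 v with h | h
    · exact measureReal_le_one.trans h
    obtain ⟨r, hr⟩ := exists_cdf_eq ν (h0.trans_lt hv) h
    rw [← hr, ProbabilityTheory.cdf_eq_real]
    refine measureReal_mono fun x hx => ?_
    by_contra hlt
    have := ProbabilityTheory.monotone_cdf ν (not_le.1 hlt).le
    have hx' : ProbabilityTheory.cdf ν x ≤ u := hx
    linarith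
  · rcases h0.eq_or_lt with rfl | h0
    · exact measureReal_nonneg
    obtain ⟨r, hr⟩ := exists_cdf_eq ν h0 h1
    have h := ProbabilityTheory.cdf_eq_real ν r
    refine (hr.symm.trans h).le.trans ?_
    exact measureReal_mono fun x hx => ((ProbabilityTheory.monotone_cdf ν hx).trans_eq hr)

open Classical in
theorem measureReal_pi_card_ge {Ω : Type*} [MeasurableSpace Ω] (P : Measure Ω)
    [IsProbabilityMeasure P] {A : Set Ω} (hA : MeasurableSet A) (m k : ℕ) :
    (Measure.pi fun _ : Fin m => P).real {Y | k ≤ (Finset.univ.filter fun j => Y j ∈ A).card}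
      = ∑ j ∈ Finset.Ico k (m + 1), (bernsteinPolynomial ℝ m j).eval (P.real A) := by
  set B : Finset (Fin m) → Set (Fin m → Ω) :=
    fun S => Set.univ.pi fun j => if j ∈ S then A else Aᶜ with hB
  have hmem : ∀ S Y, Y ∈ B S ↔ (Finset.univ.filter fun j => Y j ∈ A) = S := by
    intro S Y
    simp only [hB, Set.mem_univ_pi, Finset.ext_iff, Finset.mem_filter, Finset.mem_univ, true_and]
    refine forall_congr' fun j => ?_
    split_ifs with h <;> simp [h]
  have hset : {Y : Fin m → Ω | k ≤ (Finset.univ.filter fun j => Y j ∈ A).card}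
      = ⋃ S ∈ (Finset.univ : Finset (Finset (Fin m))).filter (k ≤ ·.card), B S := by
    ext Y
    simp only [Set.mem_ofPred_eq, Set.mem_iUnion, hmem, Finset.mem_filter, Finset.mem_univ, true_and]
    simp
  have hmeas : ∀ S, MeasurableSet (B S) := fun S =>
    MeasurableSet.univ_pi fun j => by split_ifs <;> simp [hA, hA.compl]
  have hBS : ∀ S, (Measure.pi fun _ : Fin m => P).real (B S)
      = P.real A ^ S.card * (1 - P.real A) ^ (m - S.card) := by
    intro S
    rw [measureReal_def, hB, Measure.pi_pi, ENNReal.toReal_prod]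
    have : ∀ j, (P (if j ∈ S then A else Aᶜ)).toReal
        = if j ∈ S then P.real A else 1 - P.real A := by
      intro j
      split_ifs
      · rfl
      · exact probReal_compl_eq_one_sub hA
    simp only [this]
    rw [Finset.prod_ite, Finset.prod_const, Finset.prod_const, Finset.filter_not,
      Finset.card_sdiff_of_subset (Finset.filter_subset _ _)]
    simp
  rw [hset, measureReal_biUnion_finset _ fun S _ => hmeas S]
  · simp only [hBS]
    rw [Finset.sum_filter, ← Finset.powerset_univ, Finset.sum_powerset_apply_card
      (fun c => if k ≤ c then P.real A ^ c * (1 - P.real A) ^ (m - c) else 0), Finset.card_univ,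
      Fintype.card_fin, Finset.range_eq_Ico]
    rw [← Finset.sum_filter_of_ne (p := fun c => k ≤ c)]
    · rw [Finset.Ico_filter_le, Nat.zero_max]
      refine Finset.sum_congr rfl fun j hj => ?_
      rw [if_pos (Finset.mem_Ico.1 hj).1, bernstein_eval, nsmul_eq_mul, mul_assoc]
    · intro c _ hc
      by_contra h
      simp [h] at hc
  · intro S _ T _ hST
    refine Set.disjoint_left.2 fun Y hS hT => hST ?_
    rw [hmem] at hS hT
    rw [← hS, ← hT]

/-- The measure of the region up to the `q + 1`-st smallest of `p + 1` independent copies of a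
continuously distributed variable is Beta distributed. -/
theorem map_measureReal_ordStat {Ω : Type*} [MeasurableSpace Ω] (P : Measure Ω)
    [IsProbabilityMeasure P] {D : Ω → ℝ} (hD : Measurable D) (hD0 : ∀ r, P {y | D y = r} = 0)
    {p q : ℕ} (hq : q ≤ p) :
    Measure.map (fun Y : Fin (p + 1) → Ω =>
      P.real {y | D y ≤ ordStat Finset.univ (fun j => D (Y j)) (q + 1)})
      (Measure.pi fun _ => P) = betaLaw p q := by
  classical
  set ν := P.map D with hν
  have : IsProbabilityMeasure ν := Measure.isProbabilityMeasure_map hD.aemeasurable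
  have : NullSingletonClass ν := ⟨fun r => by
    rw [hν, Measure.map_apply hD (measurableSet_singleton r)]; exact hD0 r⟩
  have hG : ∀ r, P.real {y | D y ≤ r} = ProbabilityTheory.cdf ν r := by
    intro r
    rw [ProbabilityTheory.cdf_eq_real, hν, map_measureReal_apply hD measurableSet_Iic]; rfl
  simp only [hG]
  have hmono := ProbabilityTheory.monotone_cdf ν
  have hm : Measurable fun Y : Fin (p + 1) → Ω =>
      ProbabilityTheory.cdf ν (ordStat Finset.univ (fun j => D (Y j)) (q + 1)) :=
    hmono.measurable.comp (measurable_ordStat _ (fun j _ => hD.comp (measurable_pi_apply j))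
      (by omega))
  have hfin : IsFiniteMeasure (betaLaw p q) := ⟨by rw [betaLaw_univ hq]; exact ENNReal.one_lt_top⟩
  have : IsProbabilityMeasure (Measure.map (fun Y : Fin (p + 1) → Ω =>
      ProbabilityTheory.cdf ν (ordStat Finset.univ (fun j => D (Y j)) (q + 1)))
      (Measure.pi fun _ => P)) := Measure.isProbabilityMeasure_map hm.aemeasurable
  have hle : ∀ u : ℝ, 0 ≤ u → u ≤ 1 → (Measure.map (fun Y : Fin (p + 1) → Ω =>
      ProbabilityTheory.cdf ν (ordStat Finset.univ (fun j => D (Y j)) (q + 1)))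
      (Measure.pi fun _ => P)) (Set.Iic u) = betaLaw p q (Set.Iic u) := by
    intro u h0 h1
    rw [Measure.map_apply hm measurableSet_Iic, betaLaw_Iic hq h0 h1]
    have hA : MeasurableSet {y | ProbabilityTheory.cdf ν (D y) ≤ u} :=
      (hmono.measurable.comp hD) measurableSet_Iic
    have hPA : P.real {y | ProbabilityTheory.cdf ν (D y) ≤ u} = u := by
      have h := map_measureReal_apply (μ := P) hD (hmono.measurable (measurableSet_Iic (a := u)))
      exact h.symm.trans (measureReal_cdf_le ν h0 h1)
    have h := measureReal_pi_card_ge P hA (p + 1) (q + 1)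
    rw [hPA] at h
    have hset : (fun Y : Fin (p + 1) → Ω =>
        ProbabilityTheory.cdf ν (ordStat Finset.univ (fun j => D (Y j)) (q + 1))) ⁻¹' Set.Iic u
        = {Y | q + 1 ≤ (Finset.univ.filter fun j => Y j ∈
            {y | ProbabilityTheory.cdf ν (D y) ≤ u}).card} := by
      ext Y
      rw [Set.mem_preimage, Set.mem_Iic, hmono.map_ordStat (by omega) (by simp; omega),
        ordStat_le_iff (by omega) (by simp; omega), Set.mem_ofPred_eq]
      simp only [Set.mem_ofPred_eq]
    rw [hset, ← ofReal_measureReal, h, binomialTail, Polynomial.eval_finsetSum]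
  have hzero : betaLaw p q (Set.Iio 0) = 0 := by
    refine measure_mono_null (Set.Iio_subset_Iic_self) ?_
    rw [betaLaw_Iic hq le_rfl zero_le_one, binomialTail_eval_zero, ENNReal.ofReal_zero]
  refine Measure.ext_of_Iic _ _ fun u => ?_
  rcases lt_or_ge u 0 with h0 | h0
  · rw [measure_mono_null (Set.Iic_subset_Iio.2 h0) hzero,
      Measure.map_apply hm measurableSet_Iic]
    refine (congrArg _ ?_).trans measure_empty
    refine Set.eq_empty_of_forall_notMem fun Y hY => ?_
    have := ProbabilityTheory.cdf_nonneg ν (ordStat Finset.univ (fun j => D (Y j)) (q + 1))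
    have hY' : ProbabilityTheory.cdf ν (ordStat Finset.univ (fun j => D (Y j)) (q + 1)) ≤ u := hY
    linarith
  · rcases le_or_gt u 1 with h1 | h1
    · exact hle u h0 h1
    · have hsub := Set.Iic_subset_Iic.2 h1.le
      have e1 := hle 1 zero_le_one le_rfl
      have e2 := betaLaw_Iic hq zero_le_one le_rfl
      rw [binomialTail_eval_one hq, ENNReal.ofReal_one] at e2
      rw [e2] at e1
      refine (le_antisymm prob_le_one (e1.symm.le.trans (measure_mono hsub))).trans ?_
      refine le_antisymm (e2.symm.le.trans (measure_mono hsub)) ?_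
      exact (measure_mono (Set.subset_univ _)).trans_eq (betaLaw_univ hq)

end

noncomputable section

/-! ### Periodic functions and balls on the torus -/

theorem IsPeriodic.add_intVec {d : ℕ} {f : Euc d → ℝ} (hf : IsPeriodic d f) (x : Euc d)
    (m : Fin d → ℤ) : f (x + intVec d m) = f x := by
  let H : AddSubgroup (Euc d) :=
    { carrier := {v | ∀ x, f (x + v) = f x}
      zero_mem' := fun x => by rw [add_zero]
      add_mem' := fun {a b} ha hb x => by rw [← add_assoc, hb, ha]
      neg_mem' := fun {a} ha x => by
        have := ha (x + -a)
        rw [neg_add_cancel_right] at this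
        exact this.symm }
  have h : intVec d m ∈ H := by
    have : intVec d m = ∑ i, m i • EuclideanSpace.single i (1 : ℝ) := by
      ext j
      simp [Finset.sum_apply, Pi.single_apply, mul_ite]
    rw [this]
    exact H.sum_mem fun i _ => H.zsmul_mem (fun x => hf x i) _
  exact h x

theorem torusDist_add_intVec (d : ℕ) (x y : Euc d) (m : Fin d → ℤ) :
    torusDist d x (y + intVec d m) = torusDist d x y := by
  rw [torusDist_eq_sqrt, torusDist_eq_sqrt]
  congr 1
  refine Finset.sum_congr rfl fun i _ => ?_
  simp only [PiLp.add_apply, intVec_apply, ← sub_sub, round_sub_intCast]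
  push_cast
  ring

theorem abs_sub_round_of_le {t : ℝ} (ht : |t| ≤ 1 / 2) : |t - round t| = |t| := by
  refine le_antisymm (by simpa using round_le t 0) ?_
  rcases eq_or_ne (round t) 0 with h | h
  · simp [h]
  · have h1 : (1 : ℝ) ≤ |(round t : ℝ)| := by exact_mod_cast Int.one_le_abs h
    have h2 := abs_sub_abs_le_abs_sub (round t : ℝ) t
    rw [abs_sub_comm] at h2
    linarith

theorem torusDist_eq_norm_of_le {d : ℕ} {x y : Euc d} (h : ∀ i, |x i - y i| ≤ 1 / 2) :
    torusDist d x y = ‖x - y‖ := by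
  rw [torusDist_eq_sqrt, EuclideanSpace.norm_eq]
  congr 1
  refine Finset.sum_congr rfl fun i _ => ?_
  rw [← sq_abs, abs_sub_round_of_le (h i)]; rfl

theorem volume_unitCube (d : ℕ) : volume (unitCube d) = 1 := by
  have h : unitCube d = (WithLp.ofLp : Euc d → Fin d → ℝ) ⁻¹' Set.Icc 0 1 := by
    ext x; simp [unitCube, Set.mem_Icc, Pi.le_def, forall_and]
  rw [h, (PiLp.volume_preserving_ofLp (Fin d)).measure_preimage measurableSet_Icc.nullMeasurableSet,
    Real.volume_Icc_pi]
  simp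

theorem fundamentalDomain_ae_eq_unitCube (d : ℕ) :
    (ZSpan.fundamentalDomain (EuclideanSpace.basisFun (Fin d) ℝ).toBasis : Set (Euc d))
      =ᵐ[volume] unitCube d := by
  have h1 : (ZSpan.fundamentalDomain (EuclideanSpace.basisFun (Fin d) ℝ).toBasis : Set (Euc d))
      = (WithLp.ofLp : Euc d → Fin d → ℝ) ⁻¹' (Set.univ.pi fun _ => Set.Ico 0 1) := by
    ext x; simp [ZSpan.mem_fundamentalDomain]
  have h2 : unitCube d = (WithLp.ofLp : Euc d → Fin d → ℝ) ⁻¹' Set.Icc 0 1 := by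
    ext x; simp [unitCube, Set.mem_Icc, Pi.le_def, forall_and]
  rw [h1, h2]
  exact (PiLp.volume_preserving_ofLp (Fin d)).quasiMeasurePreserving.preimage_ae_eq
    Measure.univ_pi_Ico_ae_eq_Icc

theorem exists_intVec_of_mem_span {d : ℕ} {v : Euc d}
    (hv : v ∈ Submodule.span ℤ (Set.range (EuclideanSpace.basisFun (Fin d) ℝ).toBasis)) :
    ∃ m, v = intVec d m := by
  have h := (Module.Basis.mem_span_iff_repr_mem ℤ (EuclideanSpace.basisFun (Fin d) ℝ).toBasis v).1 hv
  choose m hm using h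
  refine ⟨m, ?_⟩
  ext i
  have := hm i
  simp at this
  simp [this]

open scoped Pointwise in
/-- Integrals of periodic functions over the unit cube can be computed on any translated cube. -/
theorem lintegral_unitCube_eq {d : ℕ} {F : Euc d → ENNReal}
    (hF : ∀ x m, F (x + intVec d m) = F x) (v : Euc d) :
    ∫⁻ x in unitCube d, F x = ∫⁻ x in v +ᵥ
      (ZSpan.fundamentalDomain (EuclideanSpace.basisFun (Fin d) ℝ).toBasis : Set (Euc d)), F x := by
  set b := (EuclideanSpace.basisFun (Fin d) ℝ).toBasis
  have hfd := ZSpan.isAddFundamentalDomain' b (volume : Measure (Euc d))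
  rw [← setLIntegral_congr (fundamentalDomain_ae_eq_unitCube d)]
  have : Countable (Submodule.span ℤ (Set.range b)).toAddSubgroup :=
    inferInstanceAs (Countable (Submodule.span ℤ (Set.range b)))
  have hfd2 := hfd.vadd_of_comm v
  refine hfd.setLIntegral_eq hfd2 F fun g x => ?_
  obtain ⟨m, hm⟩ := exists_intVec_of_mem_span g.2
  have : g +ᵥ x = x + intVec d m := by
    rw [← hm, add_comm]; rfl
  rw [this, hF]

open scoped Pointwise in
theorem lintegral_unitCube_torusBall {d : ℕ} {F : Euc d → ENNReal}
    (hF : ∀ x m, F (x + intVec d m) = F x) (x : Euc d) {r : ℝ} (hr : r < 1 / 2) :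
    ∫⁻ y in unitCube d ∩ {y | torusDist d x y ≤ r}, F y = ∫⁻ y in Metric.closedBall x r, F y := by
  have hm : MeasurableSet {y | torusDist d x y ≤ r} :=
    ((measurable_torusDist d).comp measurable_prodMk_left) measurableSet_Iic
  set v : Euc d := x - WithLp.toLp 2 fun _ => (1 / 2 : ℝ) with hv
  set B : Set (Euc d) := v +ᵥ
      (ZSpan.fundamentalDomain (EuclideanSpace.basisFun (Fin d) ℝ).toBasis : Set (Euc d))
  have hB : ∀ y, y ∈ B ↔ ∀ i, y i - x i ∈ Set.Ico (-(1 / 2) : ℝ) (1 / 2) := by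
    intro y
    rw [Set.mem_vadd_set_iff_neg_vadd_mem, ZSpan.mem_fundamentalDomain]
    refine forall_congr' fun i => ?_
    simp [hv]
    constructor <;> rintro ⟨h1, h2⟩ <;> constructor <;> linarith
  have h := lintegral_unitCube_eq (F := fun y => {y | torusDist d x y ≤ r}.indicator F y)
    (fun y m => by simp only [Set.indicator_apply, Set.mem_ofPred_eq, torusDist_add_intVec, hF]) v
  rw [Set.inter_comm, ← Measure.restrict_restrict hm, ← lintegral_indicator hm, h,
    lintegral_indicator hm, Measure.restrict_restrict hm]
  congr 2
  ext y
  rw [Set.mem_inter_iff, hB, Set.mem_ofPred_eq, Metric.mem_closedBall, dist_comm, dist_eq_norm]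
  constructor
  · rintro ⟨h1, h2⟩
    rwa [← torusDist_eq_norm_of_le]
    intro i
    rw [abs_sub_comm, abs_le]
    exact ⟨(h2 i).1, (h2 i).2.le⟩
  · intro h1
    have hi : ∀ i, |x i - y i| ≤ r := fun i => (PiLp.norm_apply_le (x - y) i).trans h1
    refine ⟨?_, fun i => ?_⟩
    · rwa [torusDist_eq_norm_of_le]
      exact fun i => (hi i).trans hr.le
    · have := abs_le.1 (hi i)
      constructor <;> linarith

theorem volume_torusSphere {d : ℕ} (hd : 1 ≤ d) (x : Euc d) (r : ℝ) :
    volume {y | torusDist d x y = r} = 0 := by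
  have : Nonempty (Fin d) := ⟨⟨0, hd⟩⟩
  have hs : {y | torusDist d x y = r} ⊆ ⋃ m : Fin d → ℤ, Metric.sphere (x + intVec d m) r := by
    intro y hy
    obtain ⟨m, hm⟩ := exists_torusDist_eq_norm d x y
    refine Set.mem_iUnion.2 ⟨m, ?_⟩
    rw [Metric.mem_sphere, dist_comm, dist_eq_norm, ← hm]; exact hy
  exact measure_mono_null hs (measure_iUnion_null fun m => Measure.addHaar_sphere _ _ _)

/-! ### Hölder densities -/

section Density
variable {d : ℕ} {s L : ℝ} {f : Euc d → ℝ}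

theorem HolderDensity.continuous (hs : 0 < s) (hf : HolderDensity d s L f) : Continuous f := by
  have h := hf.1
  unfold IsHolderOrder at h
  split_ifs at h
  · rw [continuous_iff_continuousAt]
    intro x
    rw [ContinuousAt, tendsto_iff_dist_tendsto_zero]
    have h0 : Filter.Tendsto (fun y => L * ‖y - x‖ ^ s) (nhds x) (nhds 0) := by
      have : Continuous fun y : Euc d => L * ‖y - x‖ ^ s :=
        continuous_const.mul ((continuous_id.sub continuous_const).norm.rpow_const
          fun _ => Or.inr hs.le)
      have h := this.tendsto x
      simpa [zero_rpow hs.ne'] using h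
    exact squeeze_zero (fun _ => dist_nonneg) (fun y => h y x) h0
  · exact h.1.continuous

theorem HolderDensity.integrableOn (hf : HolderDensity d s L f) : IntegrableOn f (unitCube d) := by
  by_contra h
  have := hf.2.2.2
  rw [integral_undef h] at this
  exact zero_ne_one this

theorem HolderDensity.isProbabilityMeasure (hf : HolderDensity d s L f) :
    IsProbabilityMeasure (densityMeasure d f) := by
  refine ⟨?_⟩
  rw [densityMeasure, withDensity_apply _ MeasurableSet.univ, Measure.restrict_univ,
    ← ofReal_integral_eq_lintegral_ofReal hf.integrableOn (Filter.Eventually.of_forall hf.2.2.1),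
    hf.2.2.2, ENNReal.ofReal_one]

theorem densityMeasure_torusSphere (hd : 1 ≤ d) (f : Euc d → ℝ) (x : Euc d) (r : ℝ) :
    densityMeasure d f {y | torusDist d x y = r} = 0 :=
  withDensity_absolutelyContinuous _ _
    (Measure.absolutelyContinuous_of_le Measure.restrict_le_self (volume_torusSphere hd x r))

theorem densityMeasure_real_torusBall (hs : 0 < s) (hf : HolderDensity d s L f) (x : Euc d) {r : ℝ}
    (hr : r < 1 / 2) : (densityMeasure d f).real {y | torusDist d x y ≤ r}
      = ∫ y in Metric.closedBall x r, f y := by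
  have hm : MeasurableSet {y | torusDist d x y ≤ r} :=
    ((measurable_torusDist d).comp measurable_prodMk_left) measurableSet_Iic
  rw [measureReal_def, densityMeasure, withDensity_apply _ hm, Measure.restrict_restrict hm,
    Set.inter_comm, lintegral_unitCube_torusBall (fun x m => by rw [hf.2.1.add_intVec]) x hr,
    integral_eq_lintegral_of_nonneg_ae (Filter.Eventually.of_forall hf.2.2.1)
      (hf.continuous hs).aestronglyMeasurable]

theorem hasDerivAt_comp_line {f : Euc d → ℝ} (hf : ContDiff ℝ 1 f) (x z : Euc d) (t : ℝ) :
    HasDerivAt (fun t : ℝ => f (x + t • z)) (inner ℝ (gradient f (x + t • z)) z) t := by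
  have hline : HasDerivAt (fun t : ℝ => x + t • z) z t := by
    simpa using ((hasDerivAt_id t).smul_const z).const_add x
  have h := ((hf.differentiable one_ne_zero (x + t • z)).hasGradientAt).hasFDerivAt
  have h2 := h.comp_hasDerivAt t hline
  rwa [InnerProductSpace.toDual_apply_apply] at h2

theorem HolderDensity.abs_symm_diff_le (hs : 0 < s) (hs2 : s ≤ 2) (hL : 0 < L)
    (hf : HolderDensity d s L f) (x z : Euc d) :
    |f (x + z) + f (x - z) - 2 * f x| ≤ 2 * L * ‖z‖ ^ s := by
  have h := hf.1
  unfold IsHolderOrder at h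
  split_ifs at h with h1
  · have a := h (x + z) x
    have b := h (x - z) x
    rw [add_sub_cancel_left] at a
    rw [sub_sub_cancel_left, norm_neg] at b
    calc |f (x + z) + f (x - z) - 2 * f x| = |(f (x + z) - f x) + (f (x - z) - f x)| := by
          congr 1; ring
      _ ≤ _ := (abs_add_le _ _).trans (by linarith)
  · obtain ⟨hc, hg⟩ := h
    have hd1 : ∀ t : ℝ, HasDerivAt (fun t : ℝ => f (x + t • z) + f (x + t • -z))
        (inner ℝ (gradient f (x + t • z)) z + inner ℝ (gradient f (x + t • -z)) (-z)) t :=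
      fun t => (hasDerivAt_comp_line hc x z t).add (hasDerivAt_comp_line hc x (-z) t)
    have hbound : ∀ t ∈ Set.Ico (0 : ℝ) 1,
        ‖(inner ℝ (gradient f (x + t • z)) z + inner ℝ (gradient f (x + t • -z)) (-z) : ℝ)‖
          ≤ 2 * L * ‖z‖ ^ s := by
      intro t ht
      rw [inner_neg_right, ← sub_eq_add_neg, ← inner_sub_left]
      refine (norm_inner_le_norm _ _).trans ?_
      have hdiff : x + t • z - (x + t • -z) = (2 * t) • z := by
        rw [smul_neg, mul_smul, two_smul]; abel
      have h2 := hg (x + t • z) (x + t • -z)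
      rw [hdiff, norm_smul, Real.norm_eq_abs, abs_of_nonneg (by linarith [ht.1])] at h2
      have hs1 : 0 ≤ s - 1 := by linarith
      have h3 : (2 * t * ‖z‖) ^ (s - 1) ≤ 2 * ‖z‖ ^ (s - 1) := by
        rw [mul_rpow (by linarith [ht.1]) (norm_nonneg _)]
        refine mul_le_mul_of_nonneg_right ?_ (by positivity)
        calc (2 * t) ^ (s - 1) ≤ 2 ^ (s - 1) :=
              rpow_le_rpow (by linarith [ht.1]) (by linarith [ht.2]) hs1
          _ ≤ 2 ^ (1 : ℝ) := rpow_le_rpow_of_exponent_le one_le_two (by linarith)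
          _ = 2 := rpow_one 2
      have h4 : ‖z‖ ^ s = ‖z‖ ^ (s - 1) * ‖z‖ := by
        rcases (norm_nonneg z).eq_or_lt with h0 | h0
        · rw [← h0, zero_rpow hs.ne']; simp
        · nth_rewrite 3 [← rpow_one ‖z‖]
          rw [← rpow_add h0]; congr 1; ring
      calc _ ≤ L * (2 * t * ‖z‖) ^ (s - 1) * ‖z‖ := by gcongr
        _ ≤ L * (2 * ‖z‖ ^ (s - 1)) * ‖z‖ := by gcongr
        _ = _ := by rw [h4]; ring
    have := norm_image_sub_le_of_norm_deriv_le_segment_01'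
      (fun t _ => (hd1 t).hasDerivWithinAt) hbound
    simp only [one_smul, zero_smul, add_zero, ← sub_eq_add_neg, Real.norm_eq_abs] at this
    rwa [two_mul (f x)]

theorem unitBallVol_pos (d : ℕ) : 0 < unitBallVol d :=
  div_pos (rpow_pos_of_pos pi_pos _) (Gamma_pos_of_pos (by positivity))

theorem volume_real_closedBall_eq (hd : 1 ≤ d) (x : Euc d) {r : ℝ} (hr : 0 ≤ r) :
    volume.real (Metric.closedBall x r) = unitBallVol d * r ^ d := by
  have : Nonempty (Fin d) := ⟨⟨0, hd⟩⟩
  have h : √π ^ d / Gamma ((d : ℝ) / 2 + 1) = unitBallVol d := by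
    rw [unitBallVol, add_comm 1, Real.sqrt_eq_rpow, ← rpow_natCast, ← rpow_mul pi_pos.le]
    congr 2; ring
  rw [measureReal_def, EuclideanSpace.volume_closedBall, Fintype.card_fin, h, ENNReal.toReal_mul,
    ENNReal.toReal_pow, ENNReal.toReal_ofReal hr, ENNReal.toReal_ofReal (unitBallVol_pos d).le,
    mul_comm]

theorem HolderDensity.abs_ball_mass_sub_le (hd : 1 ≤ d) (hs : 0 < s) (hs2 : s ≤ 2) (hL : 0 < L)
    (hf : HolderDensity d s L f) (x : Euc d) {r : ℝ} (h0 : 0 ≤ r) (hr : r < 1 / 2) :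
    |(densityMeasure d f).real {y | torusDist d x y ≤ r} - f x * unitBallVol d * r ^ d|
      ≤ L * r ^ s * (unitBallVol d * r ^ d) := by
  have hc := hf.continuous hs
  rw [densityMeasure_real_torusBall hs hf x hr]
  set B := Metric.closedBall (0 : Euc d) r
  have hB : IsCompact B := isCompact_closedBall _ _
  have e1 : ∫ y in Metric.closedBall x r, f y = ∫ z in B, f (x + z) := by
    have h := (measurePreserving_add_left (volume : Measure (Euc d)) x).setIntegral_preimage_emb
      (MeasurableEquiv.addLeft x).measurableEmbedding f (Metric.closedBall x r)
    rw [← h]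
    congr 2
    ext z; simp [B]
  have e2 : ∫ z in B, f (x - z) = ∫ z in B, f (x + z) := by
    have h := (Measure.measurePreserving_neg (volume : Measure (Euc d))).setIntegral_preimage_emb
      (MeasurableEquiv.neg (Euc d)).measurableEmbedding (fun z => f (x + z)) B
    rw [← h]
    have hB' : Neg.neg ⁻¹' B = B := by ext z; simp [B]
    rw [hB']
    simp only [sub_eq_add_neg]
  have i1 : IntegrableOn (fun z => f (x + z)) B :=
    (by fun_prop : Continuous fun z => f (x + z)).continuousOn.integrableOn_compact hB
  have i2 : IntegrableOn (fun z => f (x - z)) B :=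
    (by fun_prop : Continuous fun z => f (x - z)).continuousOn.integrableOn_compact hB
  have hv := volume_real_closedBall_eq hd (0 : Euc d) h0
  have key : ‖∫ z in B, (f (x + z) + f (x - z) - 2 * f x)‖ ≤ 2 * L * r ^ s * volume.real B := by
    refine norm_setIntegral_le_of_norm_le_const hB.measure_lt_top fun z hz => ?_
    refine (hf.abs_symm_diff_le hs hs2 hL x z).trans ?_
    have : ‖z‖ ≤ r := by simpa [B] using hz
    gcongr
  have i3 : IntegrableOn (fun z => f (x + z) + f (x - z)) B := i1.add i2
  rw [integral_sub i3 (integrableOn_const hB.measure_lt_top.ne), integral_add i1 i2,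
    setIntegral_const, e2, hv, smul_eq_mul, Real.norm_eq_abs] at key
  rw [e1]
  rw [abs_le] at key ⊢
  constructor <;> nlinarith [key.1, key.2]

theorem HolderDensity.le_bound (hd : 1 ≤ d) (hs : 0 < s) (hs2 : s ≤ 2) (hL : 0 < L)
    (hf : HolderDensity d s L f) (x : Euc d) : f x ≤ 4 ^ d / unitBallVol d + L := by
  have := hf.isProbabilityMeasure
  have h := hf.abs_ball_mass_sub_le hd hs hs2 hL x (r := 1 / 4) (by norm_num) (by norm_num)
  have h1 : (densityMeasure d f).real {y | torusDist d x y ≤ 1 / 4} ≤ 1 := measureReal_le_one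
  have hV := unitBallVol_pos d
  have hq : ((1 : ℝ) / 4) ^ s ≤ 1 := rpow_le_one (by norm_num) (by norm_num) hs.le
  have hW : 0 < unitBallVol d * (1 / 4) ^ d := by positivity
  have h2 := (abs_le.1 h).1
  have h3 : L * (1 / 4) ^ s * (unitBallVol d * (1 / 4) ^ d) ≤ L * (unitBallVol d * (1 / 4) ^ d) := by
    nlinarith [mul_pos hL hW]
  have h4 : (f x - L) * (unitBallVol d * (1 / 4) ^ d) ≤ 1 := by linarith
  rw [← le_div_iff₀ hW] at h4
  have h5 : 1 / (unitBallVol d * (1 / 4) ^ d) = 4 ^ d / unitBallVol d := by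
    rw [one_div_pow]; field_simp
  linarith

end Density

end

noncomputable section

/-! ### Elementary estimates -/

theorem digamma_natCast_add_one (q : ℕ) :
    digamma ((q + 1 : ℕ) : ℝ) = harmonic q - eulerMascheroniConstant := by
  have h1 : DifferentiableAt ℝ Gamma ((q + 1 : ℕ) : ℝ) :=
    differentiableAt_Gamma fun m h => by
      have : (0 : ℝ) < (q + 1 : ℕ) := by positivity
      have : (0 : ℝ) ≤ m := by positivity
      linarith
  have h2 : Gamma ((q + 1 : ℕ) : ℝ) ≠ 0 := (Gamma_pos_of_pos (by positivity)).ne'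
  have h3 := deriv_Gamma_nat q
  have h4 := Gamma_nat_eq_factorial q
  rw [digamma, deriv.log h1 h2]
  push_cast at *
  rw [h3, h4, mul_div_cancel_left₀ _ (by positivity)]
  ring

theorem abs_eulerMascheroni_add_log_sub_harmonic_le (m : ℕ) :
    |eulerMascheroniConstant + log ((m : ℝ) + 1) - harmonic m| ≤ 1 / ((m : ℝ) + 1) := by
  have h1 := eulerMascheroniSeq_lt_eulerMascheroniConstant m
  have h2 := eulerMascheroniConstant_lt_eulerMascheroniSeq' (m + 1)
  rw [eulerMascheroniSeq] at h1
  rw [eulerMascheroniSeq', if_neg (by omega), harmonic_succ] at h2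
  push_cast at h2
  rw [one_div, abs_le]
  constructor <;> linarith [inv_nonneg.2 (by positivity : (0 : ℝ) ≤ (m : ℝ) + 1)]

theorem mul_log_sq_le {a M : ℝ} (h0 : 0 ≤ a) (hM : a ≤ M) : a * log a ^ 2 ≤ 16 + M ^ 3 := by
  rcases h0.eq_or_lt with rfl | h0
  · have : 0 ≤ M ^ 3 := by positivity
    linarith
  rcases le_or_gt a 1 with h1 | h1
  · have h := log_sq_le_rpow h0 h1
    have h2 : a * a ^ (-(1 / 2) : ℝ) ≤ 1 := by
      nth_rewrite 1 [← rpow_one a]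
      rw [← rpow_add h0]
      exact rpow_le_one h0.le h1 (by norm_num)
    have : 0 ≤ M ^ 3 := by have := h0.le.trans hM; positivity
    nlinarith
  · have h := log_sq_le_sq h1.le
    have : a ^ 3 ≤ M ^ 3 := pow_le_pow_left₀ h0.le hM 3
    nlinarith

theorem min_one_mul_le {K : ℝ} (x : ℝ) (hx : 0 ≤ x) : min 1 (K * x) ≤ max 1 K * min 1 x := by
  rw [mul_min_of_nonneg _ _ (le_max_of_le_left zero_le_one), mul_one]
  exact min_le_min (le_max_left _ _) (mul_le_mul_of_nonneg_right (le_max_right _ _) hx)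

theorem mul_one_add_abs_log_mul_min_le {d : ℕ} (hd : 1 ≤ d) {s M a n : ℝ} (hs : 0 < s)
    (ha : 0 < a) (haM : a ≤ M) (hn : 2 ≤ n) :
    a * (1 + |log a|) * min 1 (n ^ (-(s / d)) * a ^ (-(1 + s / d)))
      ≤ (3 + |log M|) * (n ^ (-(s / (s + d))) * log (n + 1)) := by
  have hd0 : (0 : ℝ) < d := by exact_mod_cast hd
  have hn0 : 0 < n := by linarith
  set α := n ^ (-(s / (s + d))) with hα
  have hα0 : 0 < α := rpow_pos_of_pos hn0 _
  have hlog1 : 1 ≤ log (n + 1) := by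
    rw [le_log_iff_exp_le (by linarith)]
    linarith [exp_one_lt_three]
  have hlogn : 0 ≤ log n := log_nonneg (by linarith)
  have hlogα : |log α| ≤ log (n + 1) := by
    have hle : s / (s + d) ≤ 1 := by rw [div_le_one (by positivity)]; linarith
    have h0 : 0 ≤ s / (s + d) := by positivity
    have h2 : log n ≤ log (n + 1) := log_le_log hn0 (by linarith)
    rw [hα, log_rpow hn0, abs_mul, abs_neg, abs_of_nonneg h0, abs_of_nonneg hlogn]
    nlinarith
  have hpow : n ^ (-(s / d)) = α ^ (1 + s / d) := by
    rw [hα, ← rpow_mul hn0.le]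
    congr 1
    field_simp
    ring
  have hM' : 0 ≤ |log M| := abs_nonneg _
  rcases le_or_gt a α with h | h
  · have ht : a / α ≤ 1 := (div_le_one hα0).2 h
    have h1 := (abs_log_mul_self_lt (a / α) (by positivity) ht).le
    rw [abs_mul, abs_of_pos (div_pos ha hα0), log_div ha.ne' hα0.ne'] at h1
    have h2 : |log a - log α| * a ≤ α := by
      rw [← mul_div_assoc, div_le_one hα0] at h1; exact h1
    have h3 : |log a| ≤ |log a - log α| + |log α| := by
      simpa using abs_add_le (log a - log α) (log α)
    have h4 : a * (1 + |log a|) ≤ α * (2 + |log α|) := by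
      have := mul_le_mul_of_nonneg_left h3 ha.le
      have := mul_le_mul_of_nonneg_right h (abs_nonneg (log α))
      linarith
    calc _ ≤ a * (1 + |log a|) * 1 := by gcongr; exact min_le_left _ _
      _ ≤ α * (2 + |log α|) := by linarith
      _ ≤ α * ((3 + |log M|) * log (n + 1)) := by gcongr; nlinarith
      _ = _ := by ring
  · have h1 : a * (n ^ (-(s / d)) * a ^ (-(1 + s / d))) ≤ α := by
      have e : a * (n ^ (-(s / d)) * a ^ (-(1 + s / d))) = α * (α / a) ^ (s / d) := by
        rw [hpow, div_rpow hα0.le ha.le, rpow_neg ha.le, rpow_add hα0, rpow_add ha, rpow_one,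
          rpow_one]
        have : a ^ (s / d) ≠ 0 := (rpow_pos_of_pos ha _).ne'
        field_simp
      rw [e]
      exact mul_le_of_le_one_right hα0.le
        (rpow_le_one (by positivity) ((div_le_one ha).2 h.le) (by positivity))
    have h2 : |log a| ≤ |log α| + |log M| := by
      have := log_le_log hα0 h.le
      have := log_le_log ha haM
      have := neg_abs_le (log α)
      have := le_abs_self (log M)
      rw [abs_le]; constructor <;> linarith [abs_nonneg (log α)]
    calc _ ≤ a * (1 + |log a|) * (n ^ (-(s / d)) * a ^ (-(1 + s / d))) := by
          gcongr; exact min_le_right _ _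
      _ = (a * (n ^ (-(s / d)) * a ^ (-(1 + s / d)))) * (1 + |log a|) := by ring
      _ ≤ α * (1 + (|log α| + |log M|)) := by gcongr
      _ ≤ α * ((3 + |log M|) * log (n + 1)) := by gcongr; nlinarith
      _ = _ := by ring

theorem abs_log_le_of_abs_sub_one_le {q t : ℝ} (ht : t ≤ 1 / 2) (hq : |q - 1| ≤ t) :
    |log q| ≤ 2 * t := by
  have h := abs_le.1 hq
  have h0 : 0 ≤ t := (abs_nonneg _).trans hq
  have hq0 : 0 < q := by linarith
  have h1 := log_le_sub_one_of_pos hq0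
  have h2 := one_sub_inv_le_log_of_pos hq0
  have h3 : q⁻¹ ≤ 1 + 2 * t := by
    rw [inv_le_iff_one_le_mul₀ hq0]
    nlinarith
  rw [abs_le]; constructor <;> linarith

/-- Comparison of the mass of the ball of radius `R` with its mass under a locally constant
density. -/
theorem exists_abs_log_ratio_le {d : ℕ} (hd : 1 ≤ d) {s L V M : ℝ} (hs : 0 < s) (hL : 0 < L)
    (hV : 0 < V) (hM : 0 < M) : ∃ C, 0 < C ∧ ∀ a, 0 < a → a ≤ M → ∀ G : ℝ → ℝ, Monotone G →
      (∀ r, G r ≤ 1) → (∀ r, 0 ≤ r → r < 1 / 2 → |G r - a * V * r ^ d| ≤ L * r ^ s * (V * r ^ d)) →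
      ∀ R : ℝ, 0 < R → R ≤ d → 0 < G R → |log (a * V * R ^ d / G R)|
        ≤ C * (1 + |log a|) * min 1 (G R ^ (s / d) * a ^ (-(1 + s / d))) := by
  have hd0 : (0 : ℝ) < d := by exact_mod_cast hd
  obtain ⟨ε, hε0, hεM, hεL⟩ : ∃ ε : ℝ, 0 < ε ∧ ε * M ^ (1 / s) ≤ 1 / 4 ∧ L * ε ^ s ≤ 1 / 2 := by
    have hMs : 0 < M ^ (1 / s) := rpow_pos_of_pos hM _
    have h1 : 0 < 1 / (4 * M ^ (1 / s)) := by positivity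
    have h2 : 0 < (1 / (2 * L)) ^ (1 / s) := rpow_pos_of_pos (by positivity) _
    refine ⟨min (1 / (4 * M ^ (1 / s))) ((1 / (2 * L)) ^ (1 / s)), lt_min h1 h2, ?_, ?_⟩
    · calc _ ≤ 1 / (4 * M ^ (1 / s)) * M ^ (1 / s) := by gcongr; exact min_le_left _ _
        _ = 1 / 4 := by field_simp
    · calc _ ≤ L * ((1 / (2 * L)) ^ (1 / s)) ^ s := by
            gcongr
            exact min_le_right _ _
        _ = 1 / 2 := by
          rw [← rpow_mul (by positivity), one_div_mul_cancel hs.ne', rpow_one]; field_simp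
  set c₂ : ℝ := (V * ε ^ d / 2) ^ (s / d) with hc₂
  have hc₂0 : 0 < c₂ := rpow_pos_of_pos (by positivity) _
  set C₁ : ℝ := 2 * (L * (2 / V) ^ (s / d)) with hC₁
  set C₃ : ℝ := |log (2 * d ^ d / ε ^ d)| + |log (V * ε ^ d)| + (1 + d / s) with hC₃
  have hC₃0 : 0 < C₃ := by positivity
  have hm : 0 < min 1 c₂ := lt_min one_pos hc₂0
  refine ⟨max (max 1 C₁) (C₃ / min 1 c₂), lt_max_of_lt_left (lt_max_of_lt_left one_pos), ?_⟩
  intro a ha haM G hG hG1 hGr R hR hRd hU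
  set U := G R with hUdef
  set w := U ^ (s / d) * a ^ (-(1 + s / d)) with hw
  have hw0 : 0 ≤ w := by positivity
  have hloga : 0 ≤ |log a| := abs_nonneg _
  set r₀ := ε * a ^ (1 / s) with hr₀
  have has : 0 < a ^ (1 / s) := rpow_pos_of_pos ha _
  have hr₀0 : 0 < r₀ := by positivity
  have hr₀4 : r₀ ≤ 1 / 4 := by
    refine le_trans ?_ hεM
    rw [hr₀]; gcongr
  have hr₀s : L * r₀ ^ s ≤ a / 2 := by
    rw [hr₀, mul_rpow hε0.le has.le, ← rpow_mul ha.le, one_div_mul_cancel hs.ne', rpow_one]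
    nlinarith
  have hr₀d : r₀ ^ d = ε ^ d * a ^ (d / s) := by
    rw [hr₀, mul_pow, ← rpow_natCast (a ^ (1 / s)), ← rpow_mul ha.le]
    congr 2; field_simp
  rcases le_or_gt R r₀ with h | h
  · have hVR : 0 < a * V * R ^ d := by positivity
    have hRs : L * R ^ s ≤ a / 2 := le_trans (by gcongr) hr₀s
    set t := L * R ^ s / a with ht
    have ht2 : t ≤ 1 / 2 := by rw [ht, div_le_iff₀ ha]; linarith
    have hq : |U / (a * V * R ^ d) - 1| ≤ t := by
      have h1 := hGr R hR.le (by linarith)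
      rw [show U / (a * V * R ^ d) - 1 = (U - a * V * R ^ d) / (a * V * R ^ d) by field_simp,
        abs_div, abs_of_pos hVR, div_le_iff₀ hVR, ht]
      refine h1.trans_eq ?_
      field_simp
    have hlog : |log (a * V * R ^ d / U)| ≤ 2 * t := by
      rw [← inv_div, log_inv, abs_neg]
      exact abs_log_le_of_abs_sub_one_le ht2 hq
    have hRU : R ^ d ≤ 2 / V * (U / a) := by
      have h1 := (abs_le.1 hq).1
      have h2 : 1 / 2 ≤ U / (a * V * R ^ d) := by linarith
      rw [le_div_iff₀ hVR] at h2
      rw [div_mul_div_comm, le_div_iff₀ (by positivity)]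
      linarith
    have htw : t ≤ L * (2 / V) ^ (s / d) * w := by
      have e : R ^ s = (R ^ d) ^ (s / d) := by
        rw [← rpow_natCast, ← rpow_mul hR.le]; congr 1; field_simp
      have h1 : R ^ s ≤ (2 / V) ^ (s / d) * (U ^ (s / d) / a ^ (s / d)) := by
        rw [e, ← div_rpow hU.le ha.le, ← mul_rpow (by positivity) (by positivity)]
        gcongr
      have e2 : w = U ^ (s / d) / a ^ (s / d) / a := by
        rw [hw, rpow_neg ha.le, rpow_add ha, rpow_one]
        have : a ^ (s / d) ≠ 0 := (rpow_pos_of_pos ha _).ne'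
        field_simp
      rw [e2, ht]
      calc L * R ^ s / a ≤ L * ((2 / V) ^ (s / d) * (U ^ (s / d) / a ^ (s / d))) / a := by gcongr
        _ = _ := by ring
    have h1 : |log (a * V * R ^ d / U)| ≤ min 1 (C₁ * w) :=
      le_min (by linarith) (by rw [hC₁]; linarith)
    have hmw : 0 ≤ min 1 w := le_min zero_le_one hw0
    calc _ ≤ max 1 C₁ * min 1 w := h1.trans (min_one_mul_le w hw0)
      _ ≤ max (max 1 C₁) (C₃ / min 1 c₂) * (1 + |log a|) * min 1 w := by
        gcongr
        refine (le_max_left _ (C₃ / min 1 c₂)).trans (le_mul_of_one_le_right ?_ (by linarith))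
        exact (zero_le_one.trans (le_max_left 1 C₁)).trans (le_max_left _ _)
  · have hUr : V * ε ^ d / 2 * a ^ (1 + d / s) ≤ U := by
      refine le_trans ?_ (hG h.le)
      have h1 := (abs_le.1 (hGr r₀ hr₀0.le (by linarith))).1
      have h2 : L * r₀ ^ s * (V * r₀ ^ d) ≤ a / 2 * (V * r₀ ^ d) := by gcongr
      have h3 : V * ε ^ d / 2 * a ^ (1 + d / s) = a / 2 * (V * r₀ ^ d) := by
        rw [hr₀d, rpow_add ha, rpow_one]; ring
      linarith
    have hwc : c₂ ≤ w := by
      have h1 : (V * ε ^ d / 2 * a ^ (1 + d / s)) ^ (s / d) ≤ U ^ (s / d) := by gcongr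
      rw [mul_rpow (by positivity) (by positivity), ← rpow_mul ha.le,
        show (1 + d / s) * (s / d) = 1 + s / d by field_simp; ring] at h1
      rw [hw, rpow_neg ha.le, ← div_eq_mul_inv, le_div_iff₀ (by positivity)]
      exact h1
    have hup : log (a * V * R ^ d / U) ≤ log (2 * d ^ d / ε ^ d) - d / s * log a := by
      rw [← log_rpow ha, ← log_div (by positivity) (by positivity)]
      refine log_le_log (by positivity) ?_
      calc a * V * R ^ d / U ≤ a * V * d ^ d / (V * ε ^ d / 2 * a ^ (1 + d / s)) := by gcongr
        _ = _ := by
          rw [rpow_add ha, rpow_one]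
          have : a ^ (d / s) ≠ 0 := (rpow_pos_of_pos ha _).ne'
          field_simp
    have hlo : log (V * ε ^ d) + (1 + d / s) * log a ≤ log (a * V * R ^ d / U) := by
      rw [← log_rpow ha, ← log_mul (by positivity) (by positivity)]
      refine log_le_log (by positivity) ?_
      calc V * ε ^ d * a ^ (1 + d / s) = a * V * r₀ ^ d := by
            rw [hr₀d, rpow_add ha, rpow_one]; ring
        _ ≤ a * V * R ^ d := by gcongr
        _ ≤ a * V * R ^ d / U := by
          rw [le_div_iff₀ hU]
          exact mul_le_of_le_one_right (by positivity) (hG1 R)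
    have hds : 0 < d / s := by positivity
    have habs : |log (a * V * R ^ d / U)| ≤ C₃ * (1 + |log a|) := by
      have b1 := neg_abs_le (log a)
      have b3 := le_abs_self (log (2 * d ^ d / ε ^ d))
      have b4 := neg_abs_le (log (V * ε ^ d))
      have b8 := mul_nonneg (abs_nonneg (log (2 * d ^ d / ε ^ d))) hloga
      have b9 := mul_nonneg (abs_nonneg (log (V * ε ^ d))) hloga
      have b10 := mul_nonneg hds.le hloga
      have b7 := mul_le_mul_of_nonneg_left b1 hds.le
      have b5 := abs_nonneg (log (2 * d ^ d / ε ^ d))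
      have b6 := abs_nonneg (log (V * ε ^ d))
      rw [abs_le, hC₃]
      constructor
      · refine le_trans ?_ hlo
        linarith
      · refine hup.trans ?_
        linarith
    have hmm : min 1 c₂ ≤ min 1 w := min_le_min le_rfl hwc
    calc _ ≤ C₃ * (1 + |log a|) := habs
      _ = C₃ / min 1 c₂ * (1 + |log a|) * min 1 c₂ := by field_simp
      _ ≤ _ := by
        gcongr
        exact le_max_right _ _

end

noncomputable section

/-! ### Nearest neighbour balls -/

/-- The distance from `z.1` to its `(q+1)`-st nearest neighbour among the points `z.2`. -/
def knnRadius (d p q : ℕ) (z : Euc d × (Fin (p + 1) → Euc d)) : ℝ :=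
  ordStat Finset.univ (fun j => torusDist d z.1 (z.2 j)) (q + 1)

/-- The mass under `P` of the torus ball reaching up to the `(q+1)`-st nearest neighbour. -/
def knnMass {d : ℕ} (P : Measure (Euc d)) (p q : ℕ) (z : Euc d × (Fin (p + 1) → Euc d)) : ℝ :=
  P.real {y | torusDist d z.1 y ≤ knnRadius d p q z}

theorem Measurable.torusDist {Ω : Type*} [MeasurableSpace Ω] {d : ℕ} {g h : Ω → Euc d}
    (hg : Measurable g) (hh : Measurable h) : Measurable fun ω => torusDist d (g ω) (h ω) := by
  have hgh : Measurable fun ω => (g ω, h ω) := hg.prodMk hh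
  have := (measurable_torusDist d).comp hgh
  exact this

theorem measurable_knnRadius (d p q : ℕ) : Measurable (knnRadius d p q) := by
  have h (j : Fin (p + 1)) : Measurable fun z : Euc d × (Fin (p + 1) → Euc d) => z.2 j :=
    (measurable_pi_apply j).comp measurable_snd
  have := measurable_ordStat (ι := Fin (p + 1)) Finset.univ
    (a := fun (z : Euc d × (Fin (p + 1) → Euc d)) j => torusDist d z.1 (z.2 j)) (k := q + 1)
    (fun j _ => measurable_fst.torusDist (h j)) (Nat.le_add_left 1 q)
  exact this

theorem knnRadius_mem_Icc {d p q : ℕ} (hq : q ≤ p) (z : Euc d × (Fin (p + 1) → Euc d)) :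
    knnRadius d p q z ∈ Set.Icc (0 : ℝ) d := by
  obtain ⟨j, -, hj⟩ := exists_ordStat_eq (S := (Finset.univ : Finset (Fin (p + 1))))
    (fun j => torusDist d z.1 (z.2 j)) (Nat.le_add_left 1 q) (by simpa using hq)
  rw [knnRadius, hj]
  exact ⟨torusDist_nonneg _ _ _, torusDist_le_dim _ _ _⟩

theorem measurable_knnMass {d : ℕ} (P : Measure (Euc d)) [IsProbabilityMeasure P] (p q : ℕ) :
    Measurable (knnMass P p q) := by
  have h1 : Measurable fun w : (Euc d × (Fin (p + 1) → Euc d)) × Euc d => w.1.1 :=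
    measurable_fst.comp measurable_fst
  have h2 : Measurable fun w : (Euc d × (Fin (p + 1) → Euc d)) × Euc d => knnRadius d p q w.1 :=
    (measurable_knnRadius d p q).comp measurable_fst
  have hS := measurableSet_le (h1.torusDist measurable_snd) h2
  exact (measurable_measure_prodMk_left hS).ennreal_toReal

/-- Conditionally on the centre, the mass of the nearest neighbour ball is Beta distributed. -/
theorem map_knnMass {d p q : ℕ} (hq : q ≤ p) (P : Measure (Euc d)) [IsProbabilityMeasure P]
    (hP : ∀ x r, P {y | torusDist d x y = r} = 0) :
    Measure.map (fun z => (z.1, knnMass P p q z)) (P.prod (Measure.pi fun _ : Fin (p + 1) => P))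
      = P.prod (betaLaw p q) := by
  have hm : Measurable fun z : Euc d × (Fin (p + 1) → Euc d) => (z.1, knnMass P p q z) :=
    measurable_fst.prodMk (measurable_knnMass P p q)
  have hprob : IsProbabilityMeasure (betaLaw p q) := ⟨betaLaw_univ hq⟩
  ext S hS
  rw [Measure.map_apply hm hS, Measure.prod_apply (hm hS), Measure.prod_apply hS]
  refine lintegral_congr fun x => ?_
  have hD : Measurable fun y => torusDist d x y := measurable_const.torusDist measurable_id
  have h1 : Measurable fun Y : Fin (p + 1) → Euc d => knnMass P p q (x, Y) :=
    (measurable_knnMass P p q).comp measurable_prodMk_left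
  have h2 : Measure.map (fun Y : Fin (p + 1) → Euc d => knnMass P p q (x, Y))
      (Measure.pi fun _ => P) = betaLaw p q :=
    map_measureReal_ordStat (D := fun y => torusDist d x y) P hD (hP x) hq
  rw [← h2, Measure.map_apply h1 (measurable_prodMk_left hS)]
  rfl

theorem lintegral_knnMass {d p q : ℕ} (hq : q ≤ p) (P : Measure (Euc d)) [IsProbabilityMeasure P]
    (hP : ∀ x r, P {y | torusDist d x y = r} = 0) {F : Euc d → ℝ → ENNReal}
    (hF : Measurable (Function.uncurry F)) :
    ∫⁻ z, F z.1 (knnMass P p q z) ∂(P.prod (Measure.pi fun _ : Fin (p + 1) => P))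
      = ∫⁻ x, ∫⁻ u, F x u ∂(betaLaw p q) ∂P := by
  have hm : Measurable fun z : Euc d × (Fin (p + 1) → Euc d) => (z.1, knnMass P p q z) :=
    measurable_fst.prodMk (measurable_knnMass P p q)
  have hprob : IsProbabilityMeasure (betaLaw p q) := ⟨betaLaw_univ hq⟩
  have h := lintegral_map (μ := P.prod (Measure.pi fun _ : Fin (p + 1) => P)) hF hm
  rw [map_knnMass hq P hP, lintegral_prod _ hF.aemeasurable] at h
  exact h.symm

theorem measurePreserving_knnMass {d p q : ℕ} (hq : q ≤ p) (P : Measure (Euc d))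
    [IsProbabilityMeasure P] (hP : ∀ x r, P {y | torusDist d x y = r} = 0) :
    MeasurePreserving (knnMass P p q) (P.prod (Measure.pi fun _ : Fin (p + 1) => P))
      (betaLaw p q) := by
  have hm : Measurable fun z : Euc d × (Fin (p + 1) → Euc d) => (z.1, knnMass P p q z) :=
    measurable_fst.prodMk (measurable_knnMass P p q)
  have hprob : IsProbabilityMeasure (betaLaw p q) := ⟨betaLaw_univ hq⟩
  refine ⟨measurable_knnMass P p q, ?_⟩
  have h := congrArg (Measure.map Prod.snd) (map_knnMass hq P hP)
  rw [Measure.map_map measurable_snd hm, Measure.map_snd_prod, measure_univ, one_smul] at h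
  exact h

theorem ae_betaLaw_mem (p q : ℕ) : ∀ᵐ u ∂betaLaw p q, u ∈ Set.Ioc (0 : ℝ) 1 := by
  unfold betaLaw
  refine (withDensity_absolutelyContinuous _ _).ae_le ?_
  exact ae_restrict_mem measurableSet_Ioc

theorem ae_knnMass_knnRadius {d p q : ℕ} (hq : q ≤ p) (P : Measure (Euc d))
    [IsProbabilityMeasure P] (hP : ∀ x r, P {y | torusDist d x y = r} = 0) :
    ∀ᵐ z ∂(P.prod (Measure.pi fun _ : Fin (p + 1) => P)),
      0 < knnMass P p q z ∧ knnMass P p q z ≤ 1 ∧ 0 < knnRadius d p q z := by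
  filter_upwards [(measurePreserving_knnMass hq P hP).quasiMeasurePreserving.ae
    (ae_betaLaw_mem p q)] with z hz
  refine ⟨hz.1, hz.2, (knnRadius_mem_Icc hq z).1.lt_of_ne fun h0 => hz.1.ne ?_⟩
  have : {y | torusDist d z.1 y ≤ knnRadius d p q z} = {y | torusDist d z.1 y = 0} := by
    ext y
    show torusDist d z.1 y ≤ _ ↔ torusDist d z.1 y = 0
    rw [← h0]
    exact ⟨fun h => h.antisymm (torusDist_nonneg _ _ _), fun h => h.le⟩
  rw [knnMass, this, Measure.real, hP, ENNReal.toReal_zero]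

theorem ae_densityMeasure_pos {d : ℕ} {f : Euc d → ℝ} (hf : Measurable f) :
    ∀ᵐ x ∂densityMeasure d f, 0 < f x := by
  unfold densityMeasure
  rw [ae_withDensity_iff (by fun_prop)]
  refine Filter.Eventually.of_forall fun x hx => ?_
  by_contra h
  exact hx (ENNReal.ofReal_of_nonpos (not_lt.1 h))

theorem lintegral_densityMeasure {d : ℕ} {f : Euc d → ℝ} (hf : Measurable f)
    {g : Euc d → ENNReal} (hg : Measurable g) :
    ∫⁻ x, g x ∂densityMeasure d f = ∫⁻ x in unitCube d, ENNReal.ofReal (f x) * g x := by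
  unfold densityMeasure
  rw [lintegral_withDensity_eq_lintegral_mul _ (by fun_prop) hg]
  rfl

/-- An integral over the density bounded pointwise over the unit cube. -/
theorem lintegral_densityMeasure_le {d : ℕ} {f : Euc d → ℝ} (hf : Measurable f)
    (hf0 : ∀ x, 0 ≤ f x) {g : Euc d → ℝ} (hg : Measurable g) {c : ℝ}
    (hc : ∀ x, f x * g x ≤ c) :
    ∫⁻ x, ENNReal.ofReal (g x) ∂densityMeasure d f ≤ ENNReal.ofReal c := by
  rw [lintegral_densityMeasure hf (by fun_prop)]
  calc _ ≤ ∫⁻ x in unitCube d, ENNReal.ofReal c := by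
        refine lintegral_mono fun x => ?_
        rw [← ENNReal.ofReal_mul (hf0 x)]
        exact ENNReal.ofReal_le_ofReal (hc x)
    _ = _ := by simp [volume_unitCube]

theorem integral_densityMeasure {d : ℕ} {f : Euc d → ℝ} (hf : Measurable f)
    (hf0 : ∀ x, 0 ≤ f x) (g : Euc d → ℝ) :
    ∫ x, g x ∂densityMeasure d f = ∫ x in unitCube d, f x * g x := by
  unfold densityMeasure
  have : (fun x => ENNReal.ofReal (f x)) = fun x => ((f x).toNNReal : ENNReal) := rfl
  rw [this, integral_withDensity_eq_integral_smul (by fun_prop)]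
  refine integral_congr_ae (Filter.Eventually.of_forall fun x => ?_)
  show (f x).toNNReal • g x = f x * g x
  rw [NNReal.smul_def, Real.coe_toNNReal _ (hf0 x), smul_eq_mul]

/-- The centre and the other sample points. -/
theorem measurePreserving_succAbove {E : Type*} [MeasurableSpace E] (P : Measure E)
    [IsProbabilityMeasure P] (p : ℕ) (i : Fin (p + 2)) :
    MeasurePreserving (fun X : Fin (p + 2) → E => (X i, fun j : Fin (p + 1) => X (i.succAbove j)))
      (Measure.pi fun _ => P) (P.prod (Measure.pi fun _ => P)) :=
  measurePreserving_piFinSuccAbove (fun _ : Fin (p + 2) => P) i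

theorem nnDist_eq_knnRadius (d p q : ℕ) (X : Fin (p + 2) → Euc d) (i : Fin (p + 2)) :
    nnDist d (p + 2) X i (q + 1)
      = knnRadius d p q (X i, fun j : Fin (p + 1) => X (i.succAbove j)) := by
  unfold nnDist knnRadius ordStat
  have h : (Finset.univ.erase i : Finset (Fin (p + 2)))
      = Finset.univ.map i.succAboveEmb := by
    ext j
    simp only [Finset.mem_erase, Finset.mem_univ, and_true, Finset.mem_map, true_and]
    exact (Fin.exists_succAbove_eq_iff (x := i) (y := j)).symm
  rw [h, Finset.map_val, Multiset.map_map]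
  rfl

end

noncomputable section

/-! ### Moment bounds -/

variable {d : ℕ} {s L : ℝ}

/-- The local error in the nearest neighbour approximation of `log f`, almost surely. -/
theorem exists_ae_abs_log_ratio_le (hd : 1 ≤ d) (hs : 0 < s) (hs2 : s ≤ 2) (hL : 0 < L) :
    ∃ C, 0 < C ∧ ∀ p q : ℕ, q ≤ p → ∀ f, HolderDensity d s L f →
      ∀ᵐ z ∂((densityMeasure d f).prod (Measure.pi fun _ : Fin (p + 1) => densityMeasure d f)),
        0 < f z.1 ∧ 0 < knnMass (densityMeasure d f) p q z ∧ 0 < knnRadius d p q z ∧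
        |log (f z.1 * unitBallVol d * knnRadius d p q z ^ d
            / knnMass (densityMeasure d f) p q z)|
          ≤ C * (1 + |log (f z.1)|) * min 1 (knnMass (densityMeasure d f) p q z ^ (s / d)
              * f z.1 ^ (-(1 + s / d))) := by
  have hV := unitBallVol_pos d
  obtain ⟨C, hC, h⟩ := exists_abs_log_ratio_le hd hs hL hV
    (show 0 < 4 ^ d / unitBallVol d + L by positivity)
  refine ⟨C, hC, fun p q hq f hf => ?_⟩
  have hP : IsProbabilityMeasure (densityMeasure d f) := hf.isProbabilityMeasure
  have hf0 := Measure.quasiMeasurePreserving_fst (μ := densityMeasure d f)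
    (ν := Measure.pi fun _ : Fin (p + 1) => densityMeasure d f) |>.ae
    (ae_densityMeasure_pos (hf.continuous hs).measurable)
  filter_upwards [hf0, ae_knnMass_knnRadius hq (densityMeasure d f)
    (densityMeasure_torusSphere hd f)] with z hz1 hz2
  refine ⟨hz1, hz2.1, hz2.2.2, ?_⟩
  refine h (f z.1) hz1 (hf.le_bound hd hs hs2 hL z.1)
    (fun r => (densityMeasure d f).real {y | torusDist d z.1 y ≤ r}) ?_ ?_ ?_
    (knnRadius d p q z) hz2.2.2 (knnRadius_mem_Icc hq z).2 hz2.1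
  · intro r t hrt
    exact measureReal_mono (fun y (hy : torusDist d z.1 y ≤ r) => hy.trans hrt)
  · exact fun r => measureReal_le_one
  · exact fun r h0 hr => hf.abs_ball_mass_sub_le hd hs hs2 hL z.1 h0 hr

theorem log_knn_term_eq {a U V R n k : ℝ} (ha : 0 < a) (hU : 0 < U) (hV : 0 < V) (hR : 0 < R)
    (hn : 0 < n) (hk : 0 < k) : log (n / k * (V * R ^ d))
      = log (n * U) + log (a * V * R ^ d / U) - log a - log k := by
  have hRd : 0 < R ^ d := pow_pos hR d
  rw [log_mul (by positivity) (by positivity), log_div hn.ne' hk.ne', log_mul hV.ne' hRd.ne',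
    log_mul hn.ne' hU.ne', log_div (by positivity) hU.ne', log_mul (by positivity) hRd.ne',
    log_mul ha.ne' hV.ne']
  ring

theorem HolderDensity.lintegral_log_sq_le (hd : 1 ≤ d) (hs : 0 < s) (hs2 : s ≤ 2) (hL : 0 < L)
    {f : Euc d → ℝ} (hf : HolderDensity d s L f) :
    ∫⁻ x, ENNReal.ofReal (log (f x) ^ 2) ∂densityMeasure d f
      ≤ ENNReal.ofReal (16 + (4 ^ d / unitBallVol d + L) ^ 3) := by
  have hfm := (hf.continuous hs).measurable
  exact lintegral_densityMeasure_le hfm hf.2.2.1 (g := fun x => log (f x) ^ 2)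
    (hfm.log.pow_const 2) fun x =>
    mul_log_sq_le (hf.2.2.1 x) (hf.le_bound hd hs hs2 hL x)

theorem exists_lintegral_log_sq_knn_le (hd : 1 ≤ d) (hs : 0 < s) (hs2 : s ≤ 2) (hL : 0 < L)
    (q : ℕ) {k : ℝ} (hk : 0 < k) :
    ∃ C, 0 < C ∧ ∀ p : ℕ, q ≤ p → ∀ f, HolderDensity d s L f →
      ∫⁻ z, ENNReal.ofReal (log (((p : ℝ) + 2) / k * (unitBallVol d * knnRadius d p q z ^ d)) ^ 2)
        ∂((densityMeasure d f).prod (Measure.pi fun _ : Fin (p + 1) => densityMeasure d f))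
        ≤ ENNReal.ofReal C := by
  have hV := unitBallVol_pos d
  obtain ⟨C, hC, h⟩ := exists_ae_abs_log_ratio_le hd hs hs2 hL
  set M := 16 + (4 ^ d / unitBallVol d + L) ^ 3 with hM
  have hM0 : 0 < M := by positivity
  refine ⟨4 * (32 + ((q : ℝ) + 1) * (q + 2)) + ((8 * C ^ 2 + 4) * M + (8 * C ^ 2 + 4 * log k ^ 2)),
    by positivity, fun p hq f hf => ?_⟩
  have hP : IsProbabilityMeasure (densityMeasure d f) := hf.isProbabilityMeasure
  have hfm := (hf.continuous hs).measurable
  set P := densityMeasure d f with hPdef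
  set Q := P.prod (Measure.pi fun _ : Fin (p + 1) => P) with hQ
  have hUm := measurable_knnMass P p q
  have hn : (0 : ℝ) < (p : ℝ) + 2 := by positivity
  have hmp := measurePreserving_knnMass hq P (densityMeasure_torusSphere hd f)
  have hA : ∫⁻ z, ENNReal.ofReal (log (((p : ℝ) + 2) * knnMass P p q z) ^ 2) ∂Q
      ≤ ENNReal.ofReal (32 + ((q : ℝ) + 1) * (q + 2)) := by
    rw [hmp.lintegral_comp (f := fun u => ENNReal.ofReal (log (((p : ℝ) + 2) * u) ^ 2))
      (by fun_prop)]
    exact lintegral_log_sq_betaLaw_le hq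
  have hF : ∫⁻ z, ENNReal.ofReal (log (f z.1) ^ 2) ∂Q ≤ ENNReal.ofReal M := by
    have hfst : MeasurePreserving Prod.fst Q P := measurePreserving_fst
    rw [hfst.lintegral_comp
      (f := fun x => ENNReal.ofReal (log (f x) ^ 2)) (by fun_prop)]
    exact hf.lintegral_log_sq_le hd hs hs2 hL
  calc _ ≤ ∫⁻ z, (ENNReal.ofReal 4 * ENNReal.ofReal (log (((p : ℝ) + 2) * knnMass P p q z) ^ 2)
        + (ENNReal.ofReal (8 * C ^ 2 + 4) * ENNReal.ofReal (log (f z.1) ^ 2)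
          + ENNReal.ofReal (8 * C ^ 2 + 4 * log k ^ 2))) ∂Q := by
        refine lintegral_mono_ae ?_
        filter_upwards [h p q hq f hf] with z hz
        obtain ⟨h1, h2, h3, h4⟩ := hz
        rw [← ENNReal.ofReal_mul (by positivity), ← ENNReal.ofReal_mul (by positivity),
          ← ENNReal.ofReal_add (by positivity) (by positivity),
          ← ENNReal.ofReal_add (by positivity) (by positivity)]
        refine ENNReal.ofReal_le_ofReal ?_
        rw [log_knn_term_eq h1 h2 hV h3 hn hk]
        have h5 : |log (f z.1 * unitBallVol d * knnRadius d p q z ^ d / knnMass P p q z)|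
            ≤ C * (1 + |log (f z.1)|) := by
          refine h4.trans (mul_le_of_le_one_right ?_ (min_le_left _ _))
          positivity
        generalize log (f z.1 * unitBallVol d * knnRadius d p q z ^ d / knnMass P p q z) = B at h5
        generalize log (((p : ℝ) + 2) * knnMass P p q z) = A
        have h6 : B ^ 2 ≤ C ^ 2 * (2 * (1 + log (f z.1) ^ 2)) := by
          rw [← sq_abs B]
          calc |B| ^ 2 ≤ (C * (1 + |log (f z.1)|)) ^ 2 := by gcongr
            _ = C ^ 2 * (1 + |log (f z.1)|) ^ 2 := by ring
            _ ≤ _ := by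
              gcongr
              rw [← sq_abs (log (f z.1))]
              linarith [sq_nonneg (1 - |log (f z.1)|)]
        generalize log (f z.1) = l at *
        generalize log k = m
        linarith [sq_nonneg (A - B), sq_nonneg (A + l), sq_nonneg (A + m), sq_nonneg (B + l),
          sq_nonneg (B + m), sq_nonneg (l - m)]
    _ ≤ _ := by
        rw [lintegral_add_left (by fun_prop), lintegral_add_left (by fun_prop),
          lintegral_const_mul _ (by fun_prop), lintegral_const_mul _ (by fun_prop),
          lintegral_const, measure_univ, mul_one]
        calc _ ≤ ENNReal.ofReal 4 * ENNReal.ofReal (32 + ((q : ℝ) + 1) * (q + 2))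
              + (ENNReal.ofReal (8 * C ^ 2 + 4) * ENNReal.ofReal M
                + ENNReal.ofReal (8 * C ^ 2 + 4 * log k ^ 2)) := by
              exact add_le_add (mul_le_mul_right hA _)
                (add_le_add (mul_le_mul_right hF _) le_rfl)
          _ = _ := by
              rw [← ENNReal.ofReal_mul (by positivity), ← ENNReal.ofReal_mul (by positivity),
                ← ENNReal.ofReal_add (by positivity) (by positivity),
                ← ENNReal.ofReal_add (by positivity) (by positivity)]

theorem lintegral_min_one_rpow_betaLaw_le {p q : ℕ} (hq : q ≤ p) {t c : ℝ} (ht : 0 ≤ t)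
    (ht2 : t ≤ 2) (hc : 0 ≤ c) :
    ∫⁻ u, ENNReal.ofReal (min 1 (u ^ t * c)) ∂betaLaw p q
      ≤ ENNReal.ofReal (min 1 ((1 + ((q : ℝ) + 1) * (q + 2)) * (((p : ℝ) + 2) ^ (-t) * c))) := by
  have hn : (0 : ℝ) < (p : ℝ) + 2 := by positivity
  rw [ENNReal.ofReal_min]
  refine le_min ?_ ?_
  · calc _ ≤ ∫⁻ u, ENNReal.ofReal 1 ∂betaLaw p q :=
          lintegral_mono fun u => ENNReal.ofReal_le_ofReal (min_le_left _ _)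
      _ = _ := by rw [lintegral_const, betaLaw_univ hq, mul_one]
  · calc _ ≤ ∫⁻ u, ENNReal.ofReal (((p : ℝ) + 2) ^ (-t) * c)
            * (1 + ENNReal.ofReal ((((p : ℝ) + 2) * u) ^ 2)) ∂betaLaw p q := by
          refine lintegral_mono_ae ?_
          filter_upwards [ae_betaLaw_mem p q] with u hu
          rw [← ENNReal.ofReal_one, ← ENNReal.ofReal_add (by positivity) (by positivity),
            ← ENNReal.ofReal_mul (by positivity)]
          refine ENNReal.ofReal_le_ofReal ((min_le_right _ _).trans ?_)
          have hu0 := hu.1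
          have e : u ^ t = ((p : ℝ) + 2) ^ (-t) * (((p : ℝ) + 2) * u) ^ t := by
            rw [mul_rpow hn.le hu0.le, ← mul_assoc, ← rpow_add hn, neg_add_cancel, rpow_zero,
              one_mul]
          have h1 : (((p : ℝ) + 2) * u) ^ t ≤ 1 + (((p : ℝ) + 2) * u) ^ 2 := by
            have hy : 0 ≤ ((p : ℝ) + 2) * u := by positivity
            generalize ((p : ℝ) + 2) * u = y at hy
            rcases le_total y 1 with h | h
            · linarith [rpow_le_one hy h ht, sq_nonneg y]
            · have := rpow_le_rpow_of_exponent_le h ht2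
              rw [rpow_two] at this
              linarith
          rw [e]
          calc _ = ((p : ℝ) + 2) ^ (-t) * c * (((p : ℝ) + 2) * u) ^ t := by ring
            _ ≤ _ := by gcongr
      _ ≤ _ := by
          rw [lintegral_const_mul _ (by fun_prop), lintegral_add_left (by fun_prop),
            lintegral_const, betaLaw_univ hq, mul_one, mul_comm (1 + ((q : ℝ) + 1) * (q + 2)),
            ENNReal.ofReal_mul (p := ((p : ℝ) + 2) ^ (-t) * c) (by positivity),
            ENNReal.ofReal_add (by positivity) (by positivity), ENNReal.ofReal_one]
          gcongr
          exact lintegral_sq_betaLaw_le hq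

theorem exists_lintegral_abs_log_ratio_le (hd : 1 ≤ d) (hs : 0 < s) (hs2 : s ≤ 2) (hL : 0 < L)
    (q : ℕ) : ∃ C, 0 < C ∧ ∀ p : ℕ, q ≤ p → ∀ f, HolderDensity d s L f →
      ∫⁻ z, ENNReal.ofReal |log (f z.1 * unitBallVol d * knnRadius d p q z ^ d
          / knnMass (densityMeasure d f) p q z)|
        ∂((densityMeasure d f).prod (Measure.pi fun _ : Fin (p + 1) => densityMeasure d f))
        ≤ ENNReal.ofReal
          (C * (((p : ℝ) + 2) ^ (-(s / (s + d))) * log (((p : ℝ) + 2) + 1))) := by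
  obtain ⟨C, hC, h⟩ := exists_ae_abs_log_ratio_le hd hs hs2 hL
  have hd0 : (1 : ℝ) ≤ d := by exact_mod_cast hd
  set M := 4 ^ d / unitBallVol d + L with hM
  set K : ℝ := 1 + ((q : ℝ) + 1) * (q + 2) with hK
  have hK1 : 1 ≤ K := by rw [hK]; linarith [show 0 ≤ ((q : ℝ) + 1) * (q + 2) by positivity]
  refine ⟨C * K * (3 + |log M|), by positivity, fun p hq f hf => ?_⟩
  have hP : IsProbabilityMeasure (densityMeasure d f) := hf.isProbabilityMeasure
  have hfm := (hf.continuous hs).measurable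
  set P := densityMeasure d f with hPdef
  set Q := P.prod (Measure.pi fun _ : Fin (p + 1) => P) with hQ
  set n : ℝ := (p : ℝ) + 2 with hn
  have hn2 : 2 ≤ n := by rw [hn]; linarith [Nat.cast_nonneg (α := ℝ) p]
  have hsd : 0 ≤ s / d := by positivity
  have hsd2 : s / d ≤ 2 := (div_le_self hs.le hd0).trans hs2
  set F : Euc d → ℝ → ENNReal := fun x u =>
    ENNReal.ofReal (C * (1 + |log (f x)|)) * ENNReal.ofReal (min 1 (u ^ (s / d)
              * f x ^ (-(1 + s / d)))) with hF
  have hFm : Measurable (Function.uncurry F) := by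
    have h1 : Measurable fun z : Euc d × ℝ => C * (1 + |log (f z.1)|) := by fun_prop
    have h2 : Measurable fun z : Euc d × ℝ => min 1 (z.2 ^ (s / d) * f z.1 ^ (-(1 + s / d))) := by
      fun_prop
    exact h1.ennreal_ofReal.mul h2.ennreal_ofReal
  calc _ ≤ ∫⁻ z, F z.1 (knnMass P p q z) ∂Q := by
        refine lintegral_mono_ae ?_
        filter_upwards [h p q hq f hf] with z hz
        rw [hF]
        simp only
        rw [← ENNReal.ofReal_mul (by positivity)]
        exact ENNReal.ofReal_le_ofReal hz.2.2.2
    _ = ∫⁻ x, ∫⁻ u, F x u ∂(betaLaw p q) ∂P :=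
        lintegral_knnMass hq P (densityMeasure_torusSphere hd f) hFm
    _ ≤ ∫⁻ x, ENNReal.ofReal (C * (1 + |log (f x)|) *
          (K * min 1 (n ^ (-(s / d)) * f x ^ (-(1 + s / d))))) ∂P := by
        refine lintegral_mono fun x => ?_
        have hfx := hf.2.2.1 x
        rw [ENNReal.ofReal_mul (by positivity)]
        simp only [hF]
        rw [lintegral_const_mul _ (by fun_prop)]
        gcongr
        refine (lintegral_min_one_rpow_betaLaw_le hq hsd hsd2 (rpow_nonneg hfx _)).trans
          (ENNReal.ofReal_le_ofReal ?_)
        have := min_one_mul_le (K := K) (n ^ (-(s / d)) * f x ^ (-(1 + s / d))) (by positivity)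
        rwa [max_eq_right hK1] at this
    _ ≤ _ := by
        refine lintegral_densityMeasure_le hfm hf.2.2.1 (by fun_prop) fun x => ?_
        have hlog : 0 ≤ log (n + 1) := log_nonneg (by linarith)
        rcases (hf.2.2.1 x).eq_or_lt with h0 | h0
        · rw [← h0, zero_mul]
          positivity
        · have := mul_one_add_abs_log_mul_min_le hd hs h0 (hf.le_bound hd hs hs2 hL x) hn2
          calc _ = C * K * (f x * (1 + |log (f x)|) *
                min 1 (n ^ (-(s / d)) * f x ^ (-(1 + s / d)))) := by ring
            _ ≤ C * K * ((3 + |log M|) * (n ^ (-(s / (s + d))) * log (n + 1))) := by gcongr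
            _ = _ := by ring

end

noncomputable section

/-! ### Bias -/

theorem memLp_two_of_lintegral_sq_le {α : Type*} [MeasurableSpace α] {μ : Measure α} {g : α → ℝ}
    (hg : Measurable g) {C : ℝ} (hC : 0 ≤ C)
    (h : ∫⁻ x, ENNReal.ofReal (g x ^ 2) ∂μ ≤ ENNReal.ofReal C) :
    MemLp g 2 μ ∧ ∫ x, g x ^ 2 ∂μ ≤ C := by
  have h0 : 0 ≤ᵐ[μ] fun x => g x ^ 2 := Filter.Eventually.of_forall fun x => sq_nonneg _
  refine ⟨(memLp_two_iff_integrable_sq hg.aestronglyMeasurable).2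
    ⟨(hg.pow_const 2).aestronglyMeasurable, ?_⟩, ?_⟩
  · rw [hasFiniteIntegral_iff_ofReal h0]
    exact h.trans_lt ENNReal.ofReal_lt_top
  · rw [integral_eq_lintegral_of_nonneg_ae h0 (hg.pow_const 2).aestronglyMeasurable]
    exact ENNReal.toReal_le_of_le_ofReal hC h

theorem abs_integral_le_of_lintegral_abs_le {α : Type*} [MeasurableSpace α] {μ : Measure α}
    {g : α → ℝ} {C : ℝ} (hC : 0 ≤ C)
    (h : ∫⁻ x, ENNReal.ofReal |g x| ∂μ ≤ ENNReal.ofReal C) : |∫ x, g x ∂μ| ≤ C := by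
  refine (norm_integral_le_lintegral_norm g).trans (ENNReal.toReal_le_of_le_ofReal hC ?_)
  simpa only [Real.norm_eq_abs] using h

variable {d : ℕ} {s L : ℝ}

theorem measurable_log_knnRadius (d p q : ℕ) (c v : ℝ) :
    Measurable fun z => log (c * (v * knnRadius d p q z ^ d)) := by
  have := measurable_knnRadius d p q
  fun_prop

theorem exists_abs_bias_le (hd : 1 ≤ d) (hs : 0 < s) (hs2 : s ≤ 2) (hL : 0 < L) (q : ℕ) :
    ∃ C, 0 < C ∧ ∀ p : ℕ, q ≤ p → ∀ f, HolderDensity d s L f →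
      |log ((q + 1 : ℕ) : ℝ) - digamma ((q + 1 : ℕ) : ℝ)
        + ∫ z, log (((p : ℝ) + 2) / ((q + 1 : ℕ) : ℝ) * (unitBallVol d * knnRadius d p q z ^ d))
          ∂((densityMeasure d f).prod (Measure.pi fun _ : Fin (p + 1) => densityMeasure d f))
        - diffEntropy d f|
      ≤ C * (((p : ℝ) + 2) ^ (-(s / (s + d))) * log (((p : ℝ) + 2) + 1)
        + ((p : ℝ) + 2) ^ (-(1 / 2 : ℝ))) := by
  have hV := unitBallVol_pos d
  have hk : (0 : ℝ) < ((q + 1 : ℕ) : ℝ) := by positivity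
  obtain ⟨C, hC, h⟩ := exists_lintegral_abs_log_ratio_le hd hs hs2 hL q
  obtain ⟨C₁, hC₁, h₁⟩ := exists_ae_abs_log_ratio_le hd hs hs2 hL
  obtain ⟨C₂, hC₂, h₂⟩ := exists_lintegral_log_sq_knn_le hd hs hs2 hL q hk
  refine ⟨C + 1, by positivity, fun p hq f hf => ?_⟩
  have hP : IsProbabilityMeasure (densityMeasure d f) := hf.isProbabilityMeasure
  have hfm := (hf.continuous hs).measurable
  set n : ℝ := (p : ℝ) + 2 with hn
  have hn0 : 0 < n := by positivity
  have hn2 : 2 ≤ n := by rw [hn]; linarith [Nat.cast_nonneg (α := ℝ) p]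
  set P := densityMeasure d f with hPdef
  set Q := P.prod (Measure.pi fun _ : Fin (p + 1) => P) with hQ
  set k : ℝ := ((q + 1 : ℕ) : ℝ) with hkdef
  have hprob : IsProbabilityMeasure (betaLaw p q) := ⟨betaLaw_univ hq⟩
  have hmp := measurePreserving_knnMass hq P (densityMeasure_torusSphere hd f)
  have hfst : MeasurePreserving Prod.fst Q P := measurePreserving_fst
  set ξ := fun z => log (n / k * (unitBallVol d * knnRadius d p q z ^ d)) with hξ
  have hξi : Integrable ξ Q := (memLp_two_of_lintegral_sq_le
    (measurable_log_knnRadius d p q (n / k) (unitBallVol d)) hC₂.le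
    (h₂ p hq f hf)).1.integrable one_le_two
  have hUi : Integrable (fun z => log (knnMass P p q z)) Q :=
    hmp.integrable_comp_of_integrable (integrable_log_betaLaw p q)
  have hUint : ∫ z, log (knnMass P p q z) ∂Q = harmonic q - harmonic (p + 1) := by
    rw [← integral_log_betaLaw hq, ← hmp.map_eq, integral_map hmp.measurable.aemeasurable
      measurable_log.aestronglyMeasurable]
  have hfi : Integrable (fun x => log (f x)) P := (memLp_two_of_lintegral_sq_le hfm.log
    (by positivity) (hf.lintegral_log_sq_le hd hs hs2 hL)).1.integrable one_le_two
  have hfi' : Integrable (fun z => log (f z.1)) Q := hfst.integrable_comp_of_integrable hfi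
  have hfint : ∫ z, log (f z.1) ∂Q = -diffEntropy d f := by
    have h1 : ∫ z, log (f z.1) ∂Q = ∫ x, log (f x) ∂P := by
      rw [← hfst.map_eq, integral_map hfst.measurable.aemeasurable
        hfm.log.aestronglyMeasurable]
    rw [h1, hPdef, integral_densityMeasure hfm hf.2.2.1, diffEntropy, neg_neg]
  have hae : (fun z => log (f z.1 * unitBallVol d * knnRadius d p q z ^ d / knnMass P p q z))
      =ᵐ[Q] fun z => ξ z - log (knnMass P p q z) + log (f z.1) + (log k - log n) := by
    filter_upwards [h₁ p q hq f hf] with z hz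
    obtain ⟨z1, z2, z3, -⟩ := hz
    simp only [hξ]
    rw [log_knn_term_eq z1 z2 hV z3 hn0 hk, log_mul hn0.ne' z2.ne']
    ring
  have hB := abs_integral_le_of_lintegral_abs_le (by
    have : 0 ≤ log (n + 1) := log_nonneg (by linarith)
    positivity) (h p hq f hf)
  have i1 : Integrable (fun z => ξ z - log (knnMass P p q z)) Q := hξi.sub hUi
  have i2 : Integrable (fun z => ξ z - log (knnMass P p q z) + log (f z.1)) Q := i1.add hfi'
  rw [integral_congr_ae hae, integral_add i2 (integrable_const _), integral_add i1 hfi',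
    integral_sub hξi hUi, integral_const, hUint, hfint] at hB
  simp only [probReal_univ, one_smul] at hB
  have hγ := abs_eulerMascheroni_add_log_sub_harmonic_le (p + 1)
  have e : (((p + 1 : ℕ) : ℝ) + 1) = n := by rw [hn]; push_cast; ring
  rw [e] at hγ
  have hnn : 1 / n ≤ n ^ (-(1 / 2 : ℝ)) := by
    rw [one_div, ← rpow_neg_one]
    exact rpow_le_rpow_of_exponent_le (by linarith) (by norm_num)
  rw [hkdef, digamma_natCast_add_one]
  have hlog : 0 ≤ log (n + 1) := log_nonneg (by linarith)
  have hp1 : 0 ≤ n ^ (-(s / (s + d))) * log (n + 1) := by positivity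
  have hp2 : 0 ≤ n ^ (-(1 / 2 : ℝ)) := by positivity
  have hsplit : log k - ((harmonic q : ℝ) - eulerMascheroniConstant) + ∫ z, ξ z ∂Q - diffEntropy d f
      = (eulerMascheroniConstant + log n - harmonic (p + 1))
        + (∫ z, ξ z ∂Q - ((harmonic q : ℝ) - harmonic (p + 1)) + -diffEntropy d f
          + (log k - log n)) := by ring
  have := mul_nonneg hC.le hp2
  calc _ = |log k - ((harmonic q : ℝ) - eulerMascheroniConstant) + ∫ z, ξ z ∂Q - diffEntropy d f| := rfl
    _ ≤ _ := by
      rw [hsplit]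
      refine (abs_add_le _ _).trans ((add_le_add hγ hB).trans ?_)
      linarith

/-- Moments of a function of a nearest neighbour distance in the sample. -/
theorem memLp_two_comp_nnDist {p q : ℕ} {P : Measure (Euc d)} [IsProbabilityMeasure P]
    {g : ℝ → ℝ} (hg : Measurable g) {C : ℝ} (hC : 0 ≤ C)
    (h : ∫⁻ z, ENNReal.ofReal (g (knnRadius d p q z) ^ 2)
      ∂(P.prod (Measure.pi fun _ : Fin (p + 1) => P)) ≤ ENNReal.ofReal C) (i : Fin (p + 2)) :
    MemLp (fun X => g (nnDist d (p + 2) X i (q + 1))) 2 (Measure.pi fun _ : Fin (p + 2) => P) ∧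
    ∫ X, g (nnDist d (p + 2) X i (q + 1)) ^ 2 ∂(Measure.pi fun _ : Fin (p + 2) => P) ≤ C ∧
    ∫ X, g (nnDist d (p + 2) X i (q + 1)) ∂(Measure.pi fun _ : Fin (p + 2) => P)
      = ∫ z, g (knnRadius d p q z) ∂(P.prod (Measure.pi fun _ : Fin (p + 1) => P)) := by
  have hR : Measurable fun z => g (knnRadius d p q z) := hg.comp (measurable_knnRadius d p q)
  have hmp := measurePreserving_succAbove P p i
  have hX : Measurable fun X : Fin (p + 2) → Euc d => g (nnDist d (p + 2) X i (q + 1)) := by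
    simp only [nnDist_eq_knnRadius]
    exact hR.comp hmp.measurable
  have h2 : ∫⁻ X, ENNReal.ofReal (g (nnDist d (p + 2) X i (q + 1)) ^ 2)
      ∂(Measure.pi fun _ : Fin (p + 2) => P) ≤ ENNReal.ofReal C := by
    simp only [nnDist_eq_knnRadius]
    refine le_of_eq_of_le ?_ h
    exact hmp.lintegral_comp (f := fun z => ENNReal.ofReal (g (knnRadius d p q z) ^ 2))
      (hR.pow_const 2).ennreal_ofReal
  have h3 := memLp_two_of_lintegral_sq_le hX hC h2
  refine ⟨h3.1, h3.2, ?_⟩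
  simp only [nnDist_eq_knnRadius]
  rw [← hmp.map_eq, integral_map hmp.measurable.aemeasurable hR.aestronglyMeasurable]

end

noncomputable section

/-! ### Variance and risk -/

variable {d : ℕ} {s L : ℝ}

theorem measurable_sum_ordStat_removal (d n k : ℕ) (hk : 1 ≤ k) {g : ℝ → ℝ} (hg : Measurable g)
    (j : Fin n) : Measurable fun X : Fin n → Euc d => ∑ i ∈ Finset.univ.erase j,
      g (ordStat ((Finset.univ.erase i).erase j) (fun l => torusDist d (X i) (X l)) k) := by
  refine Finset.measurable_sum _ fun i _ => hg.comp ?_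
  have := measurable_ordStat ((Finset.univ.erase i).erase j)
    (a := fun (X : Fin n → Euc d) l => torusDist d (X i) (X l)) (k := k)
    (fun l _ => (measurable_pi_apply i).torusDist (measurable_pi_apply l)) hk
  exact this

/-- Efron–Stein bound for sums of a function of the nearest neighbour distances. -/
theorem exists_variance_sum_nnDist_le (d q : ℕ) : ∃ K : ℝ, 0 ≤ K ∧ ∀ p : ℕ, q < p →
    ∀ P : Measure (Euc d), IsProbabilityMeasure P → ∀ g : ℝ → ℝ, Measurable g →
    ∀ C₁ C₂ : ℝ, 0 ≤ C₁ → 0 ≤ C₂ →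
    ∫⁻ z, ENNReal.ofReal (g (knnRadius d p q z) ^ 2)
      ∂(P.prod (Measure.pi fun _ : Fin (p + 1) => P)) ≤ ENNReal.ofReal C₁ →
    ∫⁻ z, ENNReal.ofReal (g (knnRadius d p (q + 1) z) ^ 2)
      ∂(P.prod (Measure.pi fun _ : Fin (p + 1) => P)) ≤ ENNReal.ofReal C₂ →
    ProbabilityTheory.variance (fun X => ∑ i, g (nnDist d (p + 2) X i (q + 1)))
      (Measure.pi fun _ : Fin (p + 2) => P) ≤ K * (C₁ + C₂) * ((p : ℝ) + 2) := by
  obtain ⟨K, hK, h⟩ := exists_sum_sq_removal_le d (q + 1) (Nat.le_add_left 1 q)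
  refine ⟨K, hK, fun p hqp P hP g hg C₁ C₂ hC₁ hC₂ h₁ h₂ => ?_⟩
  have m₁ := memLp_two_comp_nnDist hg hC₁ h₁
  have m₂ := memLp_two_comp_nnDist hg hC₂ h₂
  have hn : q + 1 + 1 < p + 2 := by omega
  set μ := Measure.pi fun _ : Fin (p + 2) => P with hμ
  set S : (Fin (p + 2) → Euc d) → ℝ := fun X => ∑ i, g (nnDist d (p + 2) X i (q + 1)) with hS
  set T : Fin (p + 2) → (Fin (p + 2) → Euc d) → ℝ := fun j X => ∑ i ∈ Finset.univ.erase j,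
      g (ordStat ((Finset.univ.erase i).erase j) (fun l => torusDist d (X i) (X l)) (q + 1))
    with hT
  set W : (Fin (p + 2) → Euc d) → ℝ := fun X => K * ∑ i, (g (nnDist d (p + 2) X i (q + 1)) ^ 2
    + g (nnDist d (p + 2) X i (q + 1 + 1)) ^ 2) with hW
  have hle : ∀ X, ∑ j, (S X - T j X) ^ 2 ≤ W X := fun X => h (p + 2) hn g X
  have hS2 : MemLp S 2 μ := memLp_finsetSum _ fun i _ => (m₁ i).1
  have hWi' : ∀ i, Integrable (fun X => g (nnDist d (p + 2) X i (q + 1)) ^ 2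
      + g (nnDist d (p + 2) X i (q + 1 + 1)) ^ 2) μ :=
    fun i => (m₁ i).1.integrable_sq.add (m₂ i).1.integrable_sq
  have hWi : Integrable W μ := (integrable_finsetSum _ fun i _ => hWi' i).const_mul K
  have hTm : ∀ j, Measurable (T j) := fun j =>
    measurable_sum_ordStat_removal d (p + 2) (q + 1) (Nat.le_add_left 1 q) hg j
  have hST : ∀ j, MemLp (fun X => S X - T j X) 2 μ := fun j => by
    have hm : AEStronglyMeasurable (fun X => S X - T j X) μ :=
      hS2.1.sub (hTm j).aestronglyMeasurable
    refine (memLp_two_iff_integrable_sq hm).2 (hWi.mono' (hm.pow 2)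
      (Filter.Eventually.of_forall fun X => ?_))
    rw [Real.norm_eq_abs, abs_of_nonneg (sq_nonneg _)]
    exact (Finset.single_le_sum (f := fun j => (S X - T j X) ^ 2) (fun _ _ => sq_nonneg _)
      (Finset.mem_univ j)).trans (hle X)
  have hT2 : ∀ j, MemLp (T j) 2 μ := fun j => by
    have := hS2.sub (hST j)
    refine this.ae_eq (Filter.Eventually.of_forall fun X => ?_)
    show S X - (S X - T j X) = T j X
    ring
  have hind : ∀ j X y, T j (Function.update X j y) = T j X := by
    intro j X y
    refine Finset.sum_congr rfl fun i hi => ?_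
    rw [Function.update_of_ne (Finset.ne_of_mem_erase hi)]
    congr 1
    unfold ordStat
    congr 1
    refine Multiset.map_congr rfl fun l hl => ?_
    rw [Function.update_of_ne (Finset.ne_of_mem_erase (Finset.mem_def.2 hl))]
  calc ProbabilityTheory.variance S μ ≤ ∑ j, ∫ X, (S X - T j X) ^ 2 ∂μ :=
        variance_pi_le_sum P (p + 2) S T hS2 hT2 hind
    _ = ∫ X, ∑ j, (S X - T j X) ^ 2 ∂μ :=
        (integral_finsetSum _ fun j _ => (hST j).integrable_sq).symm
    _ ≤ ∫ X, W X ∂μ := by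
        refine integral_mono (integrable_finsetSum _ fun j _ => (hST j).integrable_sq) hWi hle
    _ = K * ∑ i, (∫ X, g (nnDist d (p + 2) X i (q + 1)) ^ 2 ∂μ
          + ∫ X, g (nnDist d (p + 2) X i (q + 1 + 1)) ^ 2 ∂μ) := by
        rw [integral_const_mul, integral_finsetSum _ fun i _ => hWi' i]
        congr 1
        refine Finset.sum_congr rfl fun i _ => ?_
        exact integral_add (m₁ i).1.integrable_sq (m₂ i).1.integrable_sq
    _ ≤ K * ∑ _i : Fin (p + 2), (C₁ + C₂) := by
        gcongr with i
        · exact (m₁ i).2.1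
        · exact (m₂ i).2.1
    _ = _ := by
        rw [Finset.sum_const, Finset.card_univ, Fintype.card_fin, nsmul_eq_mul]
        push_cast
        ring

theorem variance_sum_nnDist_le {p q : ℕ} {P : Measure (Euc d)} [IsProbabilityMeasure P]
    {g : ℝ → ℝ} (hg : Measurable g) {C : ℝ} (hC : 0 ≤ C)
    (h : ∫⁻ z, ENNReal.ofReal (g (knnRadius d p q z) ^ 2)
      ∂(P.prod (Measure.pi fun _ : Fin (p + 1) => P)) ≤ ENNReal.ofReal C) :
    ProbabilityTheory.variance (fun X => ∑ i, g (nnDist d (p + 2) X i (q + 1)))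
      (Measure.pi fun _ : Fin (p + 2) => P) ≤ C * ((p : ℝ) + 2) ^ 2 := by
  have m := memLp_two_comp_nnDist hg hC h
  set μ := Measure.pi fun _ : Fin (p + 2) => P with hμ
  have hS : MemLp (fun X => ∑ i, g (nnDist d (p + 2) X i (q + 1))) 2 μ :=
    memLp_finsetSum _ fun i _ => (m i).1
  calc _ ≤ ∫ X, (∑ i, g (nnDist d (p + 2) X i (q + 1))) ^ 2 ∂μ :=
        ProbabilityTheory.variance_le_expectation_sq hS.1
    _ ≤ ∫ X, ((p : ℝ) + 2) * ∑ i, g (nnDist d (p + 2) X i (q + 1)) ^ 2 ∂μ := by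
        refine integral_mono hS.integrable_sq
          ((integrable_finsetSum _ fun i _ => (m i).1.integrable_sq).const_mul _) fun X => ?_
        have := sq_sum_le_card_mul_sum_sq (s := (Finset.univ : Finset (Fin (p + 2))))
          (f := fun i => g (nnDist d (p + 2) X i (q + 1)))
        rw [Finset.card_univ, Fintype.card_fin] at this
        push_cast at this
        exact this
    _ ≤ ((p : ℝ) + 2) * ∑ _i : Fin (p + 2), C := by
        rw [integral_const_mul, integral_finsetSum _ fun i _ => (m i).1.integrable_sq]
        gcongr with i
        exact (m i).2.1
    _ = _ := by
        rw [Finset.sum_const, Finset.card_univ, Fintype.card_fin, nsmul_eq_mul]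
        push_cast
        ring

/-- The mean square of an affine image of a random variable with controlled mean and variance. -/
theorem integral_affine_sq_eq {α : Type*} [MeasurableSpace α] {μ : Measure α}
    [IsProbabilityMeasure μ] {S : α → ℝ} (hS : MemLp S 2 μ) (a b : ℝ) :
    ∫ x, (b + a * S x) ^ 2 ∂μ
      = a ^ 2 * ProbabilityTheory.variance S μ + (b + a * ∫ x, S x ∂μ) ^ 2 := by
  have h1 : MemLp (fun x => b + a * S x) 2 μ := (memLp_const b).add (hS.const_mul a)
  have h2 := ProbabilityTheory.variance_eq_sub h1
  rw [ProbabilityTheory.variance_const_add (hS.1.const_mul a),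
    ProbabilityTheory.variance_const_mul] at h2
  have h3 : ∫ x, (b + a * S x) ∂μ = b + a * ∫ x, S x ∂μ := by
    rw [integral_add (integrable_const _) ((hS.integrable one_le_two).const_mul a),
      integral_const_mul, integral_const, probReal_univ, one_smul]
  rw [h3] at h2
  have h4 : ∫ x, (b + a * S x) ^ 2 ∂μ = ∫ x, ((fun x => b + a * S x) ^ 2) x ∂μ := rfl
  linarith

/-- The variance of the sum of the logarithmic nearest neighbour volumes is linear in `n`. -/
theorem exists_variance_sum_log_le (hd : 1 ≤ d) (hs : 0 < s) (hs2 : s ≤ 2) (hL : 0 < L) (q : ℕ) :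
    ∃ C, 0 < C ∧ ∀ p : ℕ, q ≤ p → ∀ f, HolderDensity d s L f →
      ProbabilityTheory.variance (fun X => ∑ i, log (((p : ℝ) + 2) / ((q + 1 : ℕ) : ℝ)
        * (unitBallVol d * nnDist d (p + 2) X i (q + 1) ^ d)))
        (Measure.pi fun _ : Fin (p + 2) => densityMeasure d f) ≤ C * ((p : ℝ) + 2) := by
  have hk : (0 : ℝ) < ((q + 1 : ℕ) : ℝ) := by positivity
  obtain ⟨C₁, hC₁, h₁⟩ := exists_lintegral_log_sq_knn_le hd hs hs2 hL q hk
  obtain ⟨C₂, hC₂, h₂⟩ := exists_lintegral_log_sq_knn_le hd hs hs2 hL (q + 1) hk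
  obtain ⟨K, hK, h⟩ := exists_variance_sum_nnDist_le d q
  refine ⟨K * (C₁ + C₂) + C₁ * (q + 2), by positivity, fun p hq f hf => ?_⟩
  have hP : IsProbabilityMeasure (densityMeasure d f) := hf.isProbabilityMeasure
  have hg : Measurable fun r : ℝ => log (((p : ℝ) + 2) / ((q + 1 : ℕ) : ℝ)
    * (unitBallVol d * r ^ d)) := by fun_prop
  rcases hq.eq_or_lt with rfl | hlt
  · refine (variance_sum_nnDist_le hg hC₁.le (h₁ q le_rfl f hf)).trans ?_
    have : 0 ≤ K * (C₁ + C₂) * ((q : ℝ) + 2) := by positivity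
    linarith
  · refine (h p hlt (densityMeasure d f) hP _ hg C₁ C₂ hC₁.le hC₂.le (h₁ p hq f hf)
      (h₂ p hlt f hf)).trans ?_
    gcongr
    have : 0 ≤ C₁ * ((q : ℝ) + 2) := by positivity
    linarith

theorem exists_integral_sq_klEstimator_sub_le (hd : 1 ≤ d) (hs : 0 < s) (hs2 : s ≤ 2)
    (hL : 0 < L) (q : ℕ) : ∃ C, 0 < C ∧ ∀ p : ℕ, q ≤ p → ∀ f, HolderDensity d s L f →
      ∫ X, (klEstimator d (q + 1) (p + 2) X - diffEntropy d f) ^ 2 ∂sampleMeasure d (p + 2) f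
        ≤ C * (((p : ℝ) + 2) ^ (-(s / (s + d))) * log (((p : ℝ) + 2) + 1)
          + ((p : ℝ) + 2) ^ (-(1 / 2 : ℝ))) ^ 2 := by
  have hk : (0 : ℝ) < ((q + 1 : ℕ) : ℝ) := by positivity
  obtain ⟨C₁, hC₁, h₁⟩ := exists_lintegral_log_sq_knn_le hd hs hs2 hL q hk
  obtain ⟨C₂, hC₂, h₂⟩ := exists_variance_sum_log_le hd hs hs2 hL q
  obtain ⟨C₃, hC₃, h₃⟩ := exists_abs_bias_le hd hs hs2 hL q
  refine ⟨C₂ + C₃ ^ 2, by positivity, fun p hq f hf => ?_⟩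
  have hP : IsProbabilityMeasure (densityMeasure d f) := hf.isProbabilityMeasure
  have hg : Measurable fun r : ℝ => log (((p : ℝ) + 2) / ((q + 1 : ℕ) : ℝ)
    * (unitBallVol d * r ^ d)) := by fun_prop
  have m := memLp_two_comp_nnDist hg hC₁.le (h₁ p hq f hf)
  have hv := h₂ p hq f hf
  have hb := h₃ p hq f hf
  set n : ℝ := (p : ℝ) + 2 with hn
  have hn0 : 0 < n := by positivity
  have hcast : ((p + 2 : ℕ) : ℝ) = n := by rw [hn]; push_cast; ring
  set k : ℝ := ((q + 1 : ℕ) : ℝ) with hkdef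
  set S : (Fin (p + 2) → Euc d) → ℝ := fun X => ∑ i, log (n / k
        * (unitBallVol d * nnDist d (p + 2) X i (q + 1) ^ d)) with hS
  have hS2 : MemLp S 2 (Measure.pi fun _ : Fin (p + 2) => densityMeasure d f) :=
    memLp_finsetSum _ fun i _ => (m i).1
  have hmean : 1 / n * ∫ X, S X ∂(Measure.pi fun _ : Fin (p + 2) => densityMeasure d f)
      = ∫ z, log (n / k * (unitBallVol d * knnRadius d p q z ^ d))
          ∂((densityMeasure d f).prod (Measure.pi fun _ : Fin (p + 1) => densityMeasure d f)) := by
    rw [integral_finsetSum _ fun i _ => (m i).1.integrable one_le_two,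
      Finset.sum_congr rfl fun i _ => (m i).2.2, Finset.sum_const, Finset.card_univ,
      Fintype.card_fin, nsmul_eq_mul, hcast]
    field_simp
  have heq : ∀ X, klEstimator d (q + 1) (p + 2) X - diffEntropy d f
      = (log k - digamma k - diffEntropy d f) + 1 / n * S X := by
    intro X
    rw [klEstimator, hcast]
    ring
  simp only [heq]
  rw [sampleMeasure, integral_affine_sq_eq hS2, hmean]
  set E := n ^ (-(s / (s + d))) * log (n + 1) + n ^ (-(1 / 2 : ℝ)) with hE
  have hn1 : 1 ≤ n := by rw [hn]; linarith [Nat.cast_nonneg (α := ℝ) p]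
  have hlog : 0 ≤ log (n + 1) := log_nonneg (by linarith)
  have hE0 : 0 ≤ E := by positivity
  have hnE : 1 / n ≤ E ^ 2 := by
    have e : 1 / n = (n ^ (-(1 / 2 : ℝ))) ^ 2 := by
      rw [← rpow_natCast, ← rpow_mul hn0.le, one_div, ← rpow_neg_one]
      norm_num
    have : 0 ≤ n ^ (-(s / (s + d))) * log (n + 1) := by positivity
    rw [e]
    gcongr
    linarith
  have hvar : (1 / n) ^ 2 * ProbabilityTheory.variance S
      (Measure.pi fun _ : Fin (p + 2) => densityMeasure d f) ≤ C₂ * E ^ 2 := by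
    calc _ ≤ (1 / n) ^ 2 * (C₂ * n) := by gcongr
      _ = C₂ * (1 / n) := by field_simp
      _ ≤ _ := by gcongr
  have hbias := sq_le_sq' (neg_le_of_abs_le hb) (le_of_abs_le hb)
  calc _ ≤ C₂ * E ^ 2 + (C₃ * E) ^ 2 := by
        refine add_le_add hvar (le_trans (le_of_eq ?_) hbias)
        ring
    _ = _ := by ring

end

noncomputable section

/-- Uniform risk bound for the fixed-`k` Kozachenko–Leonenko estimator
over the Hölder ball. -/
theorem kl_estimator_risk_upper_bound (d k : ℕ) (hd : 1 ≤ d) (hk : 1 ≤ k)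
    (s L : ℝ) (hs : 0 < s) (hs2 : s ≤ 2) (hL : 0 < L) :
    ∃ C : ℝ, 0 < C ∧ ∀ n : ℕ, k < n → ∀ f : Euc d → ℝ, HolderDensity d s L f →
      (∫ X, (klEstimator d k n X - diffEntropy d f) ^ 2 ∂ sampleMeasure d n f) ^ (1/2 : ℝ)
        ≤ C * ((n : ℝ) ^ (-(s / (s + d))) * Real.log (n + 1) + (n : ℝ) ^ (-(1/2 : ℝ))) := by
  obtain ⟨q, rfl⟩ := Nat.exists_eq_add_of_le' hk
  obtain ⟨C, hC, h⟩ := exists_integral_sq_klEstimator_sub_le hd hs hs2 hL q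
  refine ⟨√C, Real.sqrt_pos.2 hC, fun n hn f hf => ?_⟩
  obtain ⟨p, rfl⟩ := Nat.exists_eq_add_of_le' (show 2 ≤ n by omega)
  have h1 := h p (by omega) f hf
  have hlog : 0 ≤ log ((p : ℝ) + 2 + 1) := log_nonneg (by linarith [Nat.cast_nonneg (α := ℝ) p])
  rw [← sqrt_eq_rpow]
  push_cast
  calc _ ≤ √(C * _) := sqrt_le_sqrt h1
    _ = _ := by
      rw [sqrt_mul hC.le, sqrt_sq (by positivity)]

end
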